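/- Let H be a bipartite graph on h vertices with σ(H) = h/2 (i.e., χ_cr(H) = 2). Then there exists n_0 such that every balanced bipartite graph G on 2n vertices with n ≥ n_0 and δ(G) ≥ n/2 contains an H-tiling that covers all but at most 6h(h−1) vertices of G. -/

import Mathlib

open Finset

attribute [local instance] Classical.propDecidable

namespace BipTiling

variable {α β V : Type*}

/-- A proper 2-coloring of the graph `H`. -/
def Proper2Coloring (H : SimpleGraph α) (c : α → Bool) : Prop :=
  ∀ ⦃a b : α⦄, H.Adj a b → c a ≠ c b

/-- `H` is bipartite, i.e. it admits a proper 2-coloring. -/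
def IsBip (H : SimpleGraph α) : Prop :=
  ∃ c : α → Bool, Proper2Coloring H c

/-- The size of the color class of color `i` under the 2-coloring `c`. -/
noncomputable def colorCard [Fintype α] (c : α → Bool) (i : Bool) : ℕ :=
  (Finset.univ.filter fun v => c v = i).card

/-- `σ(H)`: the smallest size of a color class over all proper 2-colorings of `H`. -/
noncomputable def sigmaBip [Fintype α] (H : SimpleGraph α) : ℕ :=
  sInf {k | ∃ c : α → Bool, Proper2Coloring H c ∧
    k = min (colorCard c true) (colorCard c false)}

/-- The finset of connected components of `H`. -/
noncomputable def comps [Fintype α] (H : SimpleGraph α) : Finset H.ConnectedComponent :=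
  Finset.univ.image H.connectedComponentMk

/-- `c_i`: the number of vertices of the connected component `K`. -/
noncomputable def compCard [Fintype α] (H : SimpleGraph α) (K : H.ConnectedComponent) : ℕ :=
  (Finset.univ.filter fun v => H.connectedComponentMk v = K).card

/-- `d_i = |W_i| - |U_i|`: the (absolute) difference of the sizes of the two color classes
of the component `K`, computed with respect to a proper 2-coloring `c` of `H`.
(For a proper 2-coloring this is independent of the choice of `c`, since the 2-coloring of a
connected bipartite graph is unique up to swapping the colors.) -/
noncomputable def compDiff [Fintype α] (H : SimpleGraph α) (c : α → Bool)
    (K : H.ConnectedComponent) : ℕ :=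
  (((Finset.univ.filter fun v => H.connectedComponentMk v = K ∧ c v = true).card : ℤ) -
    ((Finset.univ.filter fun v => H.connectedComponentMk v = K ∧ c v = false).card : ℤ)).natAbs

/-- `hcf_c(H) = gcd(c_1, …, c_k)`. -/
noncomputable def hcfC [Fintype α] (H : SimpleGraph α) : ℕ :=
  (comps H).gcd (compCard H)

/-- `hcf_{χ,c}(H) = gcd(d_1, …, d_k)`, with respect to a proper 2-coloring `c`. -/
noncomputable def hcfChiC [Fintype α] (H : SimpleGraph α) (c : α → Bool) : ℕ :=
  (comps H).gcd (compDiff H c)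

/-- `x_2 - x_1` for the 2-coloring `c`, where `x_1 ≤ x_2` are the sizes of its color classes. -/
noncomputable def colorDiff [Fintype α] (c : α → Bool) : ℕ :=
  ((colorCard c true : ℤ) - (colorCard c false : ℤ)).natAbs

/-- `hcf_χ(H)`: the gcd of the set `D(H)` of all differences `x_2 - x_1` of color class sizes
over all proper 2-colorings of `H` (`0` represents `∞`, i.e. `D(H) = {0}`). -/
noncomputable def hcfChi [Fintype α] (H : SimpleGraph α) : ℕ :=
  (Finset.univ.filter fun c : α → Bool => Proper2Coloring H c).gcd colorDiff

/-- `hcf(H) = 1` for a bipartite graph `H`: `hcf_c(H) = 1` and `hcf_χ(H) ≤ 2`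
(in particular `hcf_χ(H)` is finite, i.e. nonzero in our encoding). -/
def HcfOne [Fintype α] (H : SimpleGraph α) : Prop :=
  hcfC H = 1 ∧ 0 < hcfChi H ∧ hcfChi H ≤ 2

/-- `f` is a copy of `H` inside `G` (an injective graph homomorphism). -/
def IsCopy (H : SimpleGraph α) (G : SimpleGraph β) (f : α → β) : Prop :=
  Function.Injective f ∧ ∀ ⦃a b : α⦄, H.Adj a b → G.Adj (f a) (f b)

/-- `s` is an `H`-tiling of `G`: a finite collection of pairwise vertex-disjoint copies of `H`. -/
def IsHTiling (H : SimpleGraph α) (G : SimpleGraph β) (s : Finset (α → β)) : Prop :=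
  (∀ f ∈ s, IsCopy H G f) ∧
    ∀ f ∈ s, ∀ g ∈ s, f ≠ g → ∀ a b : α, f a ≠ g b

/-- The set of vertices covered by the tiling `s`. -/
noncomputable def coveredSet [Fintype α] [Fintype β] (s : Finset (α → β)) : Finset β :=
  s.biUnion fun f => Finset.univ.image f

/-- `G` has a perfect `H`-tiling (`H`-factor). -/
def HasHFactor [Fintype α] [Fintype β] (H : SimpleGraph α) (G : SimpleGraph β) : Prop :=
  ∃ s : Finset (α → β), IsHTiling H G s ∧ coveredSet s = Finset.univ

/-- `G` has an `H`-tiling covering all but at most `t` vertices. -/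
def HasHTilingMissingAtMost [Fintype α] [Fintype β] (H : SimpleGraph α) (G : SimpleGraph β)
    (t : ℕ) : Prop :=
  ∃ s : Finset (α → β), IsHTiling H G s ∧ (Finset.univ \ coveredSet s).card ≤ t

/-- `G` is a bipartite graph with partition sets `X` and `Y`, written `G[X,Y]`. -/
structure BipartiteWith [Fintype V] (G : SimpleGraph V) (X Y : Finset V) : Prop where
  disj : Disjoint X Y
  cover : X ∪ Y = Finset.univ
  cross : ∀ ⦃a b : V⦄, G.Adj a b → (a ∈ X ∧ b ∈ Y) ∨ (a ∈ Y ∧ b ∈ X)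

/-- `e(A,B)`: the number of edges of `G` between `A` and `B`. -/
noncomputable def eAB (G : SimpleGraph V) (A B : Finset V) : ℕ :=
  ((A ×ˢ B).filter fun p => G.Adj p.1 p.2).card

/-- The density `d(A,B) = e(A,B)/(|A||B|)`. -/
noncomputable def dens (G : SimpleGraph V) (A B : Finset V) : ℝ :=
  (eAB G A B : ℝ) / ((A.card : ℝ) * (B.card : ℝ))

/-- `|Γ(x) ∩ B|`: the number of neighbors of `x` in `B`. -/
noncomputable def degIn (G : SimpleGraph V) (x : V) (B : Finset V) : ℕ :=
  (B.filter fun y => G.Adj x y).card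

/-- The pair `(X,Y)` is `ε`-regular in `G`. -/
def EpsRegularPair (G : SimpleGraph V) (X Y : Finset V) (ε : ℝ) : Prop :=
  ∀ A ⊆ X, ∀ B ⊆ Y, ε * X.card < A.card → ε * Y.card < B.card →
    |dens G A B - dens G X Y| < ε

/-- The pair `(X,Y)` is `(ε,δ)`-super-regular in `G`. -/
def SuperRegularPair (G : SimpleGraph V) (X Y : Finset V) (ε δ : ℝ) : Prop :=
  EpsRegularPair G X Y ε ∧
    (∀ x ∈ X, δ * Y.card < (degIn G x Y : ℝ)) ∧
    (∀ y ∈ Y, δ * X.card < (degIn G y X : ℝ))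

/-- `G[X,Y]` has an almost `(ε,d,p,q,N)`-cover. -/
def HasAlmostCover [Fintype V] (G : SimpleGraph V) (X Y : Finset V) (ε d : ℝ) (p q N : ℕ) :
    Prop :=
  ∃ (X₀ Y₀ : Finset V) (k : ℕ) (P Q : Fin k → Finset V),
    X₀ ⊆ X ∧ Y₀ ⊆ Y ∧
    (X₀.card : ℝ) ≤ ε * X.card ∧ (Y₀.card : ℝ) ≤ ε * Y.card ∧
    ((X₀ ∪ Y₀) ∪ Finset.univ.biUnion fun i => P i ∪ Q i) = Finset.univ ∧
    (∀ i, Disjoint (X₀ ∪ Y₀) (P i ∪ Q i)) ∧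
    (∀ i j, i ≠ j → Disjoint (P i ∪ Q i) (P j ∪ Q j)) ∧
    (∀ i, Disjoint (P i) (Q i)) ∧
    (∀ i, SuperRegularPair G (P i) (Q i) ε d) ∧
    (∀ i, (P i ⊆ X ∧ Q i ⊆ Y) ∨ (P i ⊆ Y ∧ Q i ⊆ X)) ∧
    (∀ i, q * (P i).card = p * (Q i).card ∧ N * p ≤ (P i).card)

/-- `G[X,Y]` (with `|X| = |Y| = n`) is in the extremal case with parameter `a`:
there are `A ⊆ X`, `B ⊆ Y` with `|A| = |B| = ⌊wn/h⌋` and `d(A,B) ≤ a`. -/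
def ExtremalWith [Fintype V] (G : SimpleGraph V) (X Y : Finset V) (w h : ℕ) (a : ℝ) : Prop :=
  ∃ A ⊆ X, ∃ B ⊆ Y, A.card = w * X.card / h ∧ B.card = w * X.card / h ∧ dens G A B ≤ a

/-- `P` and `Q` are completely joined in `G`. -/
def Joined (G : SimpleGraph V) (P Q : Finset V) : Prop :=
  ∀ x ∈ P, ∀ y ∈ Q, G.Adj x y

/-- `R` is a family of disjoint copies of `K_{t,t}`, with first classes in `X` and second
classes in `Y`. -/
structure IsTiling (G : SimpleGraph V) (X Y : Finset V) (t : ℕ)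
    (R : Finset (Finset V × Finset V)) : Prop where
  sub₁ : ∀ p ∈ R, p.1 ⊆ X
  sub₂ : ∀ p ∈ R, p.2 ⊆ Y
  card₁ : ∀ p ∈ R, p.1.card = t
  card₂ : ∀ p ∈ R, p.2.card = t
  joined : ∀ p ∈ R, Joined G p.1 p.2
  disj₁ : ∀ p ∈ R, ∀ q ∈ R, p ≠ q → Disjoint p.1 q.1
  disj₂ : ∀ p ∈ R, ∀ q ∈ R, p ≠ q → Disjoint p.2 q.2

/-- The union of the first classes of a family of pairs. -/
noncomputable def cov₁ (R : Finset (Finset V × Finset V)) : Finset V := R.biUnion Prod.fst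

/-- The union of the second classes of a family of pairs. -/
noncomputable def cov₂ (R : Finset (Finset V × Finset V)) : Finset V := R.biUnion Prod.snd

/-- `(A, B)` can be partitioned into copies of `K_{m,m}`. -/
def Tileable (G : SimpleGraph V) (m : ℕ) (A B : Finset V) : Prop :=
  ∃ R, IsTiling G A B m R ∧ cov₁ R = A ∧ cov₂ R = B

lemma Joined.symm {G : SimpleGraph V} {P Q : Finset V} (h : Joined G P Q) : Joined G Q P :=
  fun x hx y hy => (h y hy x hx).symm

lemma Joined.mono {G : SimpleGraph V} {P Q P' Q' : Finset V} (h : Joined G P Q)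
    (hP : P' ⊆ P) (hQ : Q' ⊆ Q) : Joined G P' Q' :=
  fun x hx y hy => h x (hP hx) y (hQ hy)

lemma IsTiling.subset {G : SimpleGraph V} {X Y : Finset V} {t : ℕ}
    {R R' : Finset (Finset V × Finset V)} (h : IsTiling G X Y t R) (hR : R' ⊆ R) :
    IsTiling G X Y t R' where
  sub₁ p hp := h.sub₁ p (hR hp)
  sub₂ p hp := h.sub₂ p (hR hp)
  card₁ p hp := h.card₁ p (hR hp)
  card₂ p hp := h.card₂ p (hR hp)
  joined p hp := h.joined p (hR hp)
  disj₁ p hp q hq := h.disj₁ p (hR hp) q (hR hq)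
  disj₂ p hp q hq := h.disj₂ p (hR hp) q (hR hq)

lemma IsTiling.mono {G : SimpleGraph V} {X Y X' Y' : Finset V} {t : ℕ}
    {R : Finset (Finset V × Finset V)} (h : IsTiling G X Y t R) (hX : X ⊆ X') (hY : Y ⊆ Y') :
    IsTiling G X' Y' t R :=
  { h with
    sub₁ := fun p hp => (h.sub₁ p hp).trans hX
    sub₂ := fun p hp => (h.sub₂ p hp).trans hY }

lemma fst_subset_cov₁ {R : Finset (Finset V × Finset V)} {p : Finset V × Finset V}
    (hp : p ∈ R) : p.1 ⊆ cov₁ R :=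
  Finset.subset_biUnion_of_mem Prod.fst hp

lemma snd_subset_cov₂ {R : Finset (Finset V × Finset V)} {p : Finset V × Finset V}
    (hp : p ∈ R) : p.2 ⊆ cov₂ R :=
  Finset.subset_biUnion_of_mem Prod.snd hp

lemma mem_cov₁ {R : Finset (Finset V × Finset V)} {x : V} :
    x ∈ cov₁ R ↔ ∃ p ∈ R, x ∈ p.1 := by
  simp [cov₁]

lemma mem_cov₂ {R : Finset (Finset V × Finset V)} {x : V} :
    x ∈ cov₂ R ↔ ∃ p ∈ R, x ∈ p.2 := by
  simp [cov₂]

lemma cov₁_mono {R R' : Finset (Finset V × Finset V)} (h : R' ⊆ R) : cov₁ R' ⊆ cov₁ R :=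
  Finset.biUnion_subset_biUnion_of_subset_left _ h

lemma cov₂_mono {R R' : Finset (Finset V × Finset V)} (h : R' ⊆ R) : cov₂ R' ⊆ cov₂ R :=
  Finset.biUnion_subset_biUnion_of_subset_left _ h

lemma cov₁_image_swap (R : Finset (Finset V × Finset V)) :
    cov₁ (R.image Prod.swap) = cov₂ R := by
  simp only [cov₁, cov₂, image_biUnion, Prod.fst_swap]

lemma cov₂_image_swap (R : Finset (Finset V × Finset V)) :
    cov₂ (R.image Prod.swap) = cov₁ R := by
  simp only [cov₁, cov₂, image_biUnion, Prod.snd_swap]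

lemma IsTiling.swap {G : SimpleGraph V} {X Y : Finset V} {t : ℕ}
    {R : Finset (Finset V × Finset V)} (h : IsTiling G X Y t R) :
    IsTiling G Y X t (R.image Prod.swap) := by
  constructor
  · simp only [Finset.forall_mem_image]; exact fun p hp => h.sub₂ p hp
  · simp only [Finset.forall_mem_image]; exact fun p hp => h.sub₁ p hp
  · simp only [Finset.forall_mem_image]; exact fun p hp => h.card₂ p hp
  · simp only [Finset.forall_mem_image]; exact fun p hp => h.card₁ p hp
  · simp only [Finset.forall_mem_image]; exact fun p hp => (h.joined p hp).symm
  · simp only [Finset.forall_mem_image]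
    exact fun p hp q hq hpq => h.disj₂ p hp q hq (fun e => hpq (by rw [e]))
  · simp only [Finset.forall_mem_image]
    exact fun p hp q hq hpq => h.disj₁ p hp q hq (fun e => hpq (by rw [e]))

lemma IsTiling.cov₁_subset {G : SimpleGraph V} {X Y : Finset V} {t : ℕ}
    {R : Finset (Finset V × Finset V)} (h : IsTiling G X Y t R) : cov₁ R ⊆ X :=
  Finset.biUnion_subset.2 h.sub₁

lemma IsTiling.cov₂_subset {G : SimpleGraph V} {X Y : Finset V} {t : ℕ}
    {R : Finset (Finset V × Finset V)} (h : IsTiling G X Y t R) : cov₂ R ⊆ Y :=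
  Finset.biUnion_subset.2 h.sub₂

lemma IsTiling.card_cov₁ {G : SimpleGraph V} {X Y : Finset V} {t : ℕ}
    {R : Finset (Finset V × Finset V)} (h : IsTiling G X Y t R) :
    (cov₁ R).card = R.card * t := by
  rw [cov₁, Finset.card_biUnion (fun p hp q hq hpq => h.disj₁ p hp q hq hpq),
    Finset.sum_const_nat h.card₁]

lemma IsTiling.card_cov₂ {G : SimpleGraph V} {X Y : Finset V} {t : ℕ}
    {R : Finset (Finset V × Finset V)} (h : IsTiling G X Y t R) :
    (cov₂ R).card = R.card * t := by
  rw [cov₂, Finset.card_biUnion (fun p hp q hq hpq => h.disj₂ p hp q hq hpq),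
    Finset.sum_const_nat h.card₂]

lemma IsTiling.tileable {G : SimpleGraph V} {X Y : Finset V} {t : ℕ}
    {R : Finset (Finset V × Finset V)} (h : IsTiling G X Y t R) :
    Tileable G t (cov₁ R) (cov₂ R) :=
  ⟨R, { h with
    sub₁ := fun _ hp => fst_subset_cov₁ hp
    sub₂ := fun _ hp => snd_subset_cov₂ hp }, rfl, rfl⟩

lemma Tileable.card_eq {G : SimpleGraph V} {m : ℕ} {A B : Finset V} (h : Tileable G m A B) :
    A.card = B.card := by
  obtain ⟨R, hR, rfl, rfl⟩ := h
  rw [hR.card_cov₁, hR.card_cov₂]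

lemma Tileable.swap {G : SimpleGraph V} {m : ℕ} {A B : Finset V} (h : Tileable G m A B) :
    Tileable G m B A := by
  obtain ⟨R, hR, hA, hB⟩ := h
  exact ⟨_, hR.swap, by rw [cov₁_image_swap, hB], by rw [cov₂_image_swap, hA]⟩

lemma Tileable.empty (G : SimpleGraph V) (m : ℕ) : Tileable G m ∅ ∅ :=
  ⟨∅, by constructor <;> simp, by simp [cov₁], by simp [cov₂]⟩

lemma Joined.tileable {G : SimpleGraph V} {P Q : Finset V} (h : Joined G P Q) {m : ℕ}
    (hP : P.card = m) (hQ : Q.card = m) : Tileable G m P Q :=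
  ⟨{(P, Q)}, by constructor <;> simp [hP, hQ, h], by simp [cov₁], by simp [cov₂]⟩

lemma Tileable.union {G : SimpleGraph V} {m : ℕ} {A B A' B' : Finset V}
    (h : Tileable G m A B) (h' : Tileable G m A' B') (hA : Disjoint A A')
    (hB : Disjoint B B') : Tileable G m (A ∪ A') (B ∪ B') := by
  obtain ⟨R, hR, h1, h2⟩ := h
  obtain ⟨R', hR', h1', h2'⟩ := h'
  have k := hR.mono (subset_union_left (s₂ := A')) (subset_union_left (s₂ := B'))
  have k' := hR'.mono (subset_union_right (s₁ := A)) (subset_union_right (s₁ := B))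
  refine ⟨R ∪ R', ⟨?_, ?_, ?_, ?_, ?_, ?_, ?_⟩, ?_, ?_⟩
  · exact fun p hp => (mem_union.1 hp).elim (k.sub₁ p) (k'.sub₁ p)
  · exact fun p hp => (mem_union.1 hp).elim (k.sub₂ p) (k'.sub₂ p)
  · exact fun p hp => (mem_union.1 hp).elim (k.card₁ p) (k'.card₁ p)
  · exact fun p hp => (mem_union.1 hp).elim (k.card₂ p) (k'.card₂ p)
  · exact fun p hp => (mem_union.1 hp).elim (k.joined p) (k'.joined p)
  · intro p hp q hq hpq
    rcases mem_union.1 hp with hp | hp <;> rcases mem_union.1 hq with hq | hq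
    · exact hR.disj₁ p hp q hq hpq
    · exact Disjoint.mono (hR.sub₁ p hp) (hR'.sub₁ q hq) hA
    · exact Disjoint.mono (hR'.sub₁ p hp) (hR.sub₁ q hq) hA.symm
    · exact hR'.disj₁ p hp q hq hpq
  · intro p hp q hq hpq
    rcases mem_union.1 hp with hp | hp <;> rcases mem_union.1 hq with hq | hq
    · exact hR.disj₂ p hp q hq hpq
    · exact Disjoint.mono (hR.sub₂ p hp) (hR'.sub₂ q hq) hB
    · exact Disjoint.mono (hR'.sub₂ p hp) (hR.sub₂ q hq) hB.symm
    · exact hR'.disj₂ p hp q hq hpq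
  · rw [← h1, ← h1', cov₁, cov₁, cov₁, union_biUnion]
  · rw [← h2, ← h2', cov₂, cov₂, cov₂, union_biUnion]

lemma Joined.tileable_mul {G : SimpleGraph V} {m : ℕ} (k : ℕ) :
    ∀ {P Q : Finset V}, Joined G P Q → P.card = k * m → Q.card = k * m → Tileable G m P Q := by
  induction k with
  | zero =>
    intro P Q _ hP hQ
    rw [zero_mul, card_eq_zero] at hP hQ
    subst hP hQ
    exact Tileable.empty G m
  | succ k ih =>
    intro P Q h hP hQ
    rw [add_mul, one_mul] at hP hQ
    obtain ⟨P', hP', hc⟩ := exists_subset_card_eq (show m ≤ P.card by lia)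
    obtain ⟨Q', hQ', hd⟩ := exists_subset_card_eq (show m ≤ Q.card by lia)
    have h1 : Tileable G m P' Q' := (h.mono hP' hQ').tileable hc hd
    have h2 : Tileable G m (P \ P') (Q \ Q') :=
      ih (h.mono sdiff_subset sdiff_subset)
        (by rw [card_sdiff_of_subset hP']; lia) (by rw [card_sdiff_of_subset hQ']; lia)
    have := h1.union h2 disjoint_sdiff disjoint_sdiff
    rwa [union_sdiff_of_subset hP', union_sdiff_of_subset hQ'] at this

lemma Tileable.refine {G : SimpleGraph V} {r s : ℕ} {A B : Finset V}
    (h : Tileable G (r * s) A B) : Tileable G s A B := by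
  obtain ⟨R, hR, rfl, rfl⟩ := h
  generalize hX : cov₁ R = X at hR
  generalize hY : cov₂ R = Y at hR
  rw [← hX, ← hY]
  clear hX hY
  induction R using Finset.induction_on with
  | empty => simpa [cov₁, cov₂] using Tileable.empty G s
  | insert p R hp ih =>
    have h1 := ih (hR.subset (subset_insert p R))
    have hm := mem_insert_self p R
    have h2 := (hR.joined p hm).tileable_mul r (hR.card₁ p hm) (hR.card₂ p hm)
    have := h2.union h1
      ((disjoint_biUnion_right _ _ _).2 fun q hq => hR.disj₁ p hm q (mem_insert_of_mem hq)
        (by rintro rfl; exact hp hq))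
      ((disjoint_biUnion_right _ _ _).2 fun q hq => hR.disj₂ p hm q (mem_insert_of_mem hq)
        (by rintro rfl; exact hp hq))
    rwa [cov₁, cov₂, biUnion_insert, biUnion_insert]

lemma degIn_le_card (G : SimpleGraph V) (x : V) (B : Finset V) : degIn G x B ≤ B.card :=
  card_filter_le _ _

lemma degIn_mono (G : SimpleGraph V) (x : V) {B B' : Finset V} (h : B ⊆ B') :
    degIn G x B ≤ degIn G x B' :=
  card_le_card (filter_subset_filter _ h)

lemma degIn_union_le (G : SimpleGraph V) (x : V) (B B' : Finset V) :
    degIn G x (B ∪ B') ≤ degIn G x B + degIn G x B' := by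
  rw [degIn, filter_union]
  exact card_union_le _ _

lemma degIn_le_add_sdiff (G : SimpleGraph V) (x : V) (B C : Finset V) :
    degIn G x B ≤ degIn G x C + (B \ C).card := by
  calc degIn G x B ≤ degIn G x (C ∪ B \ C) := degIn_mono G x (by simp)
    _ ≤ degIn G x C + degIn G x (B \ C) := degIn_union_le G x C _
    _ ≤ _ := by gcongr; exact degIn_le_card G x _

lemma degIn_biUnion_le {ι : Type*} (G : SimpleGraph V) (x : V) (s : Finset ι)
    (f : ι → Finset V) : degIn G x (s.biUnion f) ≤ ∑ i ∈ s, degIn G x (f i) := by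
  rw [degIn, filter_biUnion]
  exact card_biUnion_le

lemma sum_degIn_comm (G : SimpleGraph V) (A B : Finset V) :
    ∑ a ∈ A, degIn G a B = ∑ b ∈ B, degIn G b A := by
  have := sum_card_bipartiteAbove_eq_sum_card_bipartiteBelow (s := A) (t := B) G.Adj
  simp only [bipartiteAbove, bipartiteBelow] at this
  simp only [degIn]
  rw [this]
  exact sum_congr rfl fun b _ => by simp only [G.adj_comm]

lemma card_filter_mul_add_ge {ι : Type*} (s : Finset ι) (f : ι → ℝ) {M c : ℝ} (hc : 0 ≤ c)
    (hM : ∀ i ∈ s, f i ≤ M) :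
    ∑ i ∈ s, f i ≤ (s.filter fun i => c ≤ f i).card * M + s.card * c := by
  rw [← sum_filter_add_sum_filter_not s (fun i => c ≤ f i)]
  refine add_le_add ?_ ?_
  · rw [← nsmul_eq_mul]
    exact sum_le_card_nsmul _ _ _ fun i hi => hM i (mem_filter.1 hi).1
  · calc _ ≤ ((s.filter fun i => ¬ c ≤ f i).card : ℝ) * c := by
          rw [← nsmul_eq_mul]
          exact sum_le_card_nsmul _ _ _ fun i hi => (not_le.1 (mem_filter.1 hi).2).le
      _ ≤ _ := by gcongr; exact filter_subset _ _

lemma exists_joined_of_sum_degIn {G : SimpleGraph V} {A Q : Finset V} {s : ℕ}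
    (h : s * A.card + 2 ^ Q.card * s * Q.card < ∑ a ∈ A, degIn G a Q) :
    ∃ A' ⊆ A, ∃ Q' ⊆ Q, A'.card = s ∧ Q'.card = s ∧ Joined G A' Q' := by
  set A₁ := A.filter fun a => s ≤ degIn G a Q with hA₁
  have hsum : ∑ a ∈ A, degIn G a Q ≤ A₁.card * Q.card + A.card * s := by
    have := card_filter_mul_add_ge A (fun a => (degIn G a Q : ℝ)) (M := Q.card) (c := s)
      (by positivity) (fun i _ => by exact_mod_cast degIn_le_card G i Q)
    simp only [Nat.cast_le] at this
    exact_mod_cast this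
  have hlt : 2 ^ Q.card * s < A₁.card := by
    by_contra! hle
    have := Nat.mul_le_mul_right Q.card hle
    lia
  obtain ⟨N, hN, hlt'⟩ := exists_lt_card_fiber_of_mul_lt_card_of_maps_to
    (s := A₁) (t := Q.powerset) (f := fun a => Q.filter fun y => G.Adj a y) (n := s)
    (fun a _ => mem_powerset.2 (filter_subset _ _)) (by rwa [card_powerset])
  obtain ⟨A', hA', hA'c⟩ := exists_subset_card_eq hlt'.le
  obtain ⟨a₀, ha₀⟩ : (filter (fun a => (Q.filter fun y => G.Adj a y) = N) A₁).Nonempty := by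
    rw [← card_pos]; lia
  have hNs : s ≤ N.card := by
    have h1 := (mem_filter.1 ha₀).2
    have h2 := (mem_filter.1 (mem_filter.1 ha₀).1).2
    rwa [degIn, h1] at h2
  obtain ⟨Q', hQ', hQ'c⟩ := exists_subset_card_eq hNs
  refine ⟨A', fun a ha => (mem_filter.1 (mem_filter.1 (hA' ha)).1).1, Q',
    hQ'.trans (mem_powerset.1 hN), hA'c, hQ'c, fun x hx y hy => ?_⟩
  have h1 := (mem_filter.1 (hA' hx)).2
  have h2 := hQ' hy
  rw [← h1] at h2
  exact (mem_filter.1 h2).2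

/-- A Kővári–Sós–Turán type statement: dense bipartite graphs contain `K_{s,s}`. -/
lemma exists_joined_of_dense (s : ℕ) {δ : ℝ} (hδ : 0 < δ) :
    ∃ n₀ : ℕ, ∀ (V : Type) (G : SimpleGraph V) (A B : Finset V) (n : ℕ), n₀ ≤ n →
      A.card ≤ n → B.card ≤ n → δ * n ^ 2 ≤ ∑ a ∈ A, (degIn G a B : ℝ) →
      ∃ A' ⊆ A, ∃ B' ⊆ B, A'.card = s ∧ B'.card = s ∧ Joined G A' B' := by
  set t : ℕ := ⌈2 * (s + 1) / δ⌉₊ with ht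
  have ht' : 2 * (s + 1) / δ ≤ t := Nat.le_ceil _
  rw [div_le_iff₀ hδ] at ht'
  refine ⟨2 ^ t * s * t + ⌈2 * t / δ⌉₊ + 1, fun V G A B n hn hA hB hd => ?_⟩
  have hn0 : (0 : ℝ) < n := by exact_mod_cast (by lia : 0 < n)
  have hn1 : 2 * t / δ ≤ n := (Nat.le_ceil _).trans (by exact_mod_cast (by lia))
  rw [div_le_iff₀ hδ] at hn1
  have hA' : (A.card : ℝ) ≤ n := by exact_mod_cast hA
  have hB' : (B.card : ℝ) ≤ n := by exact_mod_cast hB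
  have hcomm : ∑ a ∈ A, (degIn G a B : ℝ) = ∑ b ∈ B, (degIn G b A : ℝ) := by
    exact_mod_cast sum_degIn_comm G A B
  rw [hcomm] at hd
  have h1 := card_filter_mul_add_ge B (fun b => (degIn G b A : ℝ)) (M := n) (c := δ / 2 * n)
    (by positivity) (fun i _ => le_trans (by exact_mod_cast degIn_le_card G i A) hA')
  set B₁ := B.filter fun b => δ / 2 * n ≤ (degIn G b A : ℝ)
  have h2 : (B.card : ℝ) * (δ / 2 * n) ≤ n * (δ / 2 * n) := by gcongr
  have h3 : (t : ℝ) ≤ B₁.card := by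
    have : (δ / 2 * n) * n ≤ B₁.card * n := by nlinarith
    have := le_of_mul_le_mul_right this hn0
    linarith
  obtain ⟨Q, hQ, hQc⟩ := exists_subset_card_eq (show t ≤ B₁.card by exact_mod_cast h3)
  have h4 : (s + 1 : ℝ) * n ≤ ∑ a ∈ A, (degIn G a Q : ℝ) := by
    have : ∑ a ∈ A, (degIn G a Q : ℝ) = ∑ b ∈ Q, (degIn G b A : ℝ) := by
      exact_mod_cast sum_degIn_comm G A Q
    rw [this]
    calc (s + 1 : ℝ) * n ≤ Q.card • (δ / 2 * n) := by
          rw [hQc, nsmul_eq_mul]; nlinarith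
      _ ≤ _ := card_nsmul_le_sum _ _ _ fun b hb => (mem_filter.1 (hQ hb)).2
  have h5 : (s + 1) * n ≤ ∑ a ∈ A, degIn G a Q := by exact_mod_cast h4
  obtain ⟨A', hA'', Q', hQ', h⟩ := exists_joined_of_sum_degIn (G := G) (A := A) (Q := Q) (s := s)
    (by
      rw [hQc]
      have := Nat.mul_le_mul_left s hA
      lia)
  exact ⟨A', hA'', Q', hQ'.trans (hQ.trans (filter_subset _ _)), h⟩

lemma exists_augmentation (s r : ℕ) {γ : ℝ} (hγ : 0 < γ) (hr : 8 ≤ γ * r) :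
    ∃ n₀ : ℕ, ∀ (V : Type) (G : SimpleGraph V) (X Y : Finset V) (n : ℕ), n₀ ≤ n →
      X.card = n → Y.card = n →
      (∀ x ∈ X, (n : ℝ) / 2 ≤ degIn G x Y) → (∀ y ∈ Y, (n : ℝ) / 2 ≤ degIn G y X) →
      ∀ (R : Finset (Finset V × Finset V)) (A B U W : Finset V),
      IsTiling G X Y (r * s) R → A ⊆ X → B ⊆ Y → Disjoint A (cov₁ R) → Disjoint B (cov₂ R) →
      X ⊆ A ∪ U ∪ cov₁ R → Y ⊆ B ∪ W ∪ cov₂ R → A.card = B.card →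
      (U.card : ℝ) ≤ γ ^ 2 / 64 * n → (W.card : ℝ) ≤ γ ^ 2 / 64 * n → γ * n ≤ A.card →
      (∃ A' ⊆ A, ∃ B' ⊆ B, A'.card = s ∧ B'.card = s ∧ Joined G A' B') ∨
      ∃ p ∈ R, (∃ A' ⊆ A, ∃ Q' ⊆ p.2, A'.card = s ∧ Q'.card = s ∧ Joined G A' Q') ∧
        ∃ P' ⊆ p.1, ∃ B' ⊆ B, P'.card = s ∧ B'.card = s ∧ Joined G P' B' := by
  obtain ⟨n₁, hn₁⟩ := exists_joined_of_dense s (δ := γ ^ 2 / 64) (by positivity)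
  rcases Nat.eq_zero_or_pos s with rfl | hs
  · refine ⟨0, fun V G X Y n _ _ _ _ _ R A B U W _ _ _ _ _ _ _ _ _ _ _ => Or.inl ?_⟩
    exact ⟨∅, empty_subset _, ∅, empty_subset _, rfl, rfl, by simp [Joined]⟩
  have hr0 : 0 < r := by
    rcases Nat.eq_zero_or_pos r with rfl | h
    · norm_num at hr
    · exact h
  set t := r * s with ht
  have ht0 : 0 < t := by positivity
  set C : ℕ := 2 ^ t * s * t with hC
  refine ⟨n₁ + ⌈16 * C / γ ^ 2⌉₊ + 1, fun V G X Y n hn hX hY hdX hdY R A B U W hR hAX hBY hAR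
    hBR hXc hYc hAB hU hW hγA => ?_⟩
  by_contra! hcon
  obtain ⟨hcon1, hcon2⟩ := hcon
  have hn0 : (0 : ℝ) < n := by exact_mod_cast (by lia : 0 < n)
  have hnC : 16 * C / γ ^ 2 ≤ n := (Nat.le_ceil _).trans (by exact_mod_cast (by lia))
  rw [div_le_iff₀ (by positivity)] at hnC
  have hAn : A.card ≤ n := hX ▸ card_le_card hAX
  have hBn : B.card ≤ n := hY ▸ card_le_card hBY
  have hsparse : ∑ a ∈ A, (degIn G a B : ℝ) < γ ^ 2 / 64 * n ^ 2 := by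
    by_contra! h
    obtain ⟨A', hA', B', hB', h1, h2, h3⟩ := hn₁ V G A B n (by lia) hAn hBn h
    exact hcon1 A' hA' B' hB' h1 h2 h3
  have hsparse' : ∑ b ∈ B, (degIn G b A : ℝ) < γ ^ 2 / 64 * n ^ 2 := by
    have : ∑ a ∈ A, (degIn G a B : ℝ) = ∑ b ∈ B, (degIn G b A : ℝ) := by
      exact_mod_cast sum_degIn_comm G A B
    linarith
  have htile : ∀ p ∈ R, ∑ a ∈ A, degIn G a p.2 + ∑ b ∈ B, degIn G b p.1 ≤
      (t + s) * A.card + C := by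
    intro p hp
    have hc1 := hR.card₁ p hp
    have hc2 := hR.card₂ p hp
    by_cases h1 : s * A.card + 2 ^ p.2.card * s * p.2.card < ∑ a ∈ A, degIn G a p.2
    · have h2 : ¬ (s * B.card + 2 ^ p.1.card * s * p.1.card < ∑ b ∈ B, degIn G b p.1) := by
        intro h2
        obtain ⟨B', hB', P', hP', k1, k2, k3⟩ := exists_joined_of_sum_degIn h2
        obtain ⟨A', hA', Q', hQ', l1, l2, l3⟩ := exists_joined_of_sum_degIn h1
        exact hcon2 p hp ⟨A', hA', Q', hQ', l1, l2, l3⟩ P' hP' B' hB' k2 k1 k3.symm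
      have h3 : ∑ a ∈ A, degIn G a p.2 ≤ A.card * t := by
        rw [← smul_eq_mul]
        exact sum_le_card_nsmul _ _ _ fun a _ => hc2 ▸ degIn_le_card G a p.2
      rw [hc1, ← hAB] at h2
      lia
    · have h3 : ∑ b ∈ B, degIn G b p.1 ≤ A.card * t := by
        rw [← smul_eq_mul, hAB]
        exact sum_le_card_nsmul _ _ _ fun b _ => hc1 ▸ degIn_le_card G b p.1
      rw [hc2] at h1
      lia
  have hsumA : (A.card : ℝ) * (n / 2) ≤ γ ^ 2 / 64 * n ^ 2 + A.card * (γ ^ 2 / 64 * n) +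
      ∑ p ∈ R, ∑ a ∈ A, (degIn G a p.2 : ℝ) := by
    rw [sum_comm]
    calc (A.card : ℝ) * (n / 2) = ∑ a ∈ A, (n / 2 : ℝ) := by simp
      _ ≤ ∑ a ∈ A, ((degIn G a B : ℝ) + γ ^ 2 / 64 * n + ∑ p ∈ R, (degIn G a p.2 : ℝ)) := by
          refine sum_le_sum fun a ha => (hdX a (hAX ha)).trans ?_
          have h1 : degIn G a Y ≤ degIn G a B + W.card + ∑ p ∈ R, degIn G a p.2 :=
            calc degIn G a Y ≤ degIn G a (B ∪ W ∪ cov₂ R) := degIn_mono G a hYc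
              _ ≤ degIn G a (B ∪ W) + degIn G a (cov₂ R) := degIn_union_le G a _ _
              _ ≤ degIn G a B + degIn G a W + degIn G a (cov₂ R) := by
                gcongr; exact degIn_union_le G a _ _
              _ ≤ _ := by
                gcongr
                · exact degIn_le_card G a W
                · exact degIn_biUnion_le G a R Prod.snd
          have h2 : (degIn G a Y : ℝ) ≤ degIn G a B + W.card + ∑ p ∈ R, (degIn G a p.2 : ℝ) := by
            exact_mod_cast h1
          linarith
      _ ≤ _ := by
          rw [sum_add_distrib, sum_add_distrib, sum_const, nsmul_eq_mul]
          linarith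
  have hsumB : (A.card : ℝ) * (n / 2) ≤ γ ^ 2 / 64 * n ^ 2 + A.card * (γ ^ 2 / 64 * n) +
      ∑ p ∈ R, ∑ b ∈ B, (degIn G b p.1 : ℝ) := by
    rw [sum_comm, hAB]
    calc (B.card : ℝ) * (n / 2) = ∑ b ∈ B, (n / 2 : ℝ) := by simp
      _ ≤ ∑ b ∈ B, ((degIn G b A : ℝ) + γ ^ 2 / 64 * n + ∑ p ∈ R, (degIn G b p.1 : ℝ)) := by
          refine sum_le_sum fun b hb => (hdY b (hBY hb)).trans ?_
          have h1 : degIn G b X ≤ degIn G b A + U.card + ∑ p ∈ R, degIn G b p.1 :=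
            calc degIn G b X ≤ degIn G b (A ∪ U ∪ cov₁ R) := degIn_mono G b hXc
              _ ≤ degIn G b (A ∪ U) + degIn G b (cov₁ R) := degIn_union_le G b _ _
              _ ≤ degIn G b A + degIn G b U + degIn G b (cov₁ R) := by
                gcongr; exact degIn_union_le G b _ _
              _ ≤ _ := by
                gcongr
                · exact degIn_le_card G b U
                · exact degIn_biUnion_le G b R Prod.fst
          have h2 : (degIn G b X : ℝ) ≤ degIn G b A + U.card + ∑ p ∈ R, (degIn G b p.1 : ℝ) := by
            exact_mod_cast h1
          linarith
      _ ≤ _ := by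
          rw [sum_add_distrib, sum_add_distrib, sum_const, nsmul_eq_mul]
          linarith
  have hsumR : ∑ p ∈ R, ∑ a ∈ A, (degIn G a p.2 : ℝ) + ∑ p ∈ R, ∑ b ∈ B, (degIn G b p.1 : ℝ) ≤
      R.card * ((t + s) * A.card + C) := by
    rw [← sum_add_distrib, ← nsmul_eq_mul]
    exact sum_le_card_nsmul _ _ _ fun p hp => by exact_mod_cast htile p hp
  have hRt : R.card * t + A.card ≤ n := by
    rw [← hR.card_cov₁, ← hX, ← card_union_of_disjoint hAR.symm]
    exact card_le_card (union_subset hR.cov₁_subset hAX)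
  have hRt' : (R.card : ℝ) * t + A.card ≤ n := by exact_mod_cast hRt
  have hRn : (R.card : ℝ) ≤ n := by
    have : R.card * 1 ≤ R.card * t := Nat.mul_le_mul_left _ ht0
    exact_mod_cast (by lia : R.card ≤ n)
  have hts : (8 : ℝ) * s ≤ γ * t := by
    have : (t : ℝ) = r * s := by exact_mod_cast ht
    rw [this]
    have := mul_le_mul_of_nonneg_right hr (Nat.cast_nonneg (α := ℝ) s)
    linarith
  set a : ℝ := (A.card : ℝ) with ha
  have ha0 : 0 < a := lt_of_lt_of_le (by positivity) hγA
  have han : a ≤ n := by rw [ha]; exact_mod_cast hAn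
  have e1 : (R.card : ℝ) * t * a ≤ (n - a) * a := by
    gcongr; linarith
  have e2 : (R.card : ℝ) * s * a ≤ a * a / 8 := by
    have h1 : (R.card : ℝ) * (8 * s) ≤ γ * n := by
      calc (R.card : ℝ) * (8 * s) ≤ R.card * (γ * t) := by gcongr
        _ = γ * (R.card * t) := by ring
        _ ≤ γ * n := by gcongr; linarith
    have h2 : (R.card : ℝ) * (8 * s) * a ≤ a * a := by gcongr; linarith
    linarith
  have e3 : (R.card : ℝ) * C ≤ n * C := by gcongr
  have e4 : (n : ℝ) * C * 16 ≤ (γ * n) * (γ * n) := by nlinarith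
  have e5 : (γ * n) * (γ * n) ≤ a * a := by gcongr
  have e6 : a * (γ ^ 2 / 64 * n) ≤ n * (γ ^ 2 / 64 * n) := by gcongr
  have e7 : 0 < a * a := by positivity
  nlinarith

lemma exists_improvement (s r : ℕ) {γ : ℝ} (hγ : 0 < γ) (hr : 8 ≤ γ * r) :
    ∃ n₀ : ℕ, ∀ (V : Type) (G : SimpleGraph V) (X Y : Finset V) (n : ℕ), n₀ ≤ n →
      X.card = n → Y.card = n →
      (∀ x ∈ X, (n : ℝ) / 2 ≤ degIn G x Y) → (∀ y ∈ Y, (n : ℝ) / 2 ≤ degIn G y X) →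
      ∀ (R₀ : Finset (Finset V × Finset V)), IsTiling G X Y (r * s) R₀ →
      ∀ k : ℕ, (k : ℝ) * (r * s + s) ≤ γ ^ 2 / 64 * n →
      (∃ A ⊆ X, ∃ B ⊆ Y, Tileable G s A B ∧ (n : ℝ) - γ * n ≤ A.card) ∨
      ∃ R U W, IsTiling G X Y (r * s) R ∧ U ⊆ X ∧ W ⊆ Y ∧ Tileable G s U W ∧
        Disjoint U (cov₁ R) ∧ Disjoint W (cov₂ R) ∧ U.card ≤ k * (r * s + s) ∧
        R.card * (r * s) + U.card = R₀.card * (r * s) + k * s := by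
  obtain ⟨n₀, hn₀⟩ := exists_augmentation s r hγ hr
  refine ⟨n₀, fun V G X Y n hn hX hY hdX hdY R₀ hR₀ k => ?_⟩
  have hr0 : 0 < r := by
    rcases Nat.eq_zero_or_pos r with rfl | h
    · norm_num at hr
    · exact h
  induction k with
  | zero =>
    intro _
    exact Or.inr ⟨R₀, ∅, ∅, hR₀, empty_subset _, empty_subset _, Tileable.empty G s,
      disjoint_empty_left _, disjoint_empty_left _, by simp, by simp⟩
  | succ k ih =>
    intro hk
    have hk' : (k : ℝ) * (r * s + s) ≤ γ ^ 2 / 64 * n := by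
      refine le_trans ?_ hk
      gcongr
      lia
    rcases ih hk' with h | ⟨R, U, W, hR, hUX, hWY, hUW, hUR, hWR, hUk, hcard⟩
    · exact Or.inl h
    have hcov : (cov₁ R ∪ U).card = R.card * (r * s) + U.card := by
      rw [card_union_of_disjoint hUR.symm, hR.card_cov₁]
    have hcov' : (cov₂ R ∪ W).card = R.card * (r * s) + U.card := by
      rw [card_union_of_disjoint hWR.symm, hR.card_cov₂, hUW.card_eq]
    have hsub : cov₁ R ∪ U ⊆ X := union_subset hR.cov₁_subset hUX
    have hsub' : cov₂ R ∪ W ⊆ Y := union_subset hR.cov₂_subset hWY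
    by_cases hbig : (n : ℝ) - γ * n ≤ (cov₁ R ∪ U).card
    · exact Or.inl ⟨_, hsub, _, hsub', hR.tileable.refine.union hUW hUR.symm hWR.symm, hbig⟩
    right
    set A := X \ (cov₁ R ∪ U) with hA
    set B := Y \ (cov₂ R ∪ W) with hB
    have hAc : A.card + (cov₁ R ∪ U).card = n := by
      rw [hA, card_sdiff_add_card_eq_card hsub, hX]
    have hBc : B.card + (cov₂ R ∪ W).card = n := by
      rw [hB, card_sdiff_add_card_eq_card hsub', hY]
    have hAcR : (A.card : ℝ) + (cov₁ R ∪ U).card = n := by exact_mod_cast hAc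
    have hAdis : Disjoint A (cov₁ R ∪ U) := sdiff_disjoint
    have hBdis : Disjoint B (cov₂ R ∪ W) := sdiff_disjoint
    rw [disjoint_union_right] at hAdis hBdis
    have hUn : (U.card : ℝ) ≤ γ ^ 2 / 64 * n := by
      refine le_trans ?_ hk'
      exact_mod_cast hUk
    have hnew : ∀ A' ⊆ A, ∀ B' ⊆ B, A' ⊆ X ∧ B' ⊆ Y := fun A' hA' B' hB' =>
      ⟨hA'.trans sdiff_subset, hB'.trans sdiff_subset⟩
    rcases hn₀ V G X Y n hn hX hY hdX hdY R A B U W hR sdiff_subset sdiff_subset hAdis.1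
      hBdis.1 (by intro x hx; simp only [hA, mem_union, mem_sdiff]; tauto)
      (by intro x hx; simp only [hB, mem_union, mem_sdiff]; tauto) (by lia) hUn
      (by rw [← hUW.card_eq]; exact hUn) (by linarith) with
      ⟨A', hA', B', hB', hA's, hB's, hj⟩ |
      ⟨p, hp, ⟨A', hA', Q', hQ', hA's, hQ's, hj⟩, P', hP', B', hB', hP's, hB's, hj'⟩
    · have d1 : Disjoint U A' := (hAdis.2.mono_left hA').symm
      have d2 : Disjoint W B' := (hBdis.2.mono_left hB').symm
      refine ⟨R, U ∪ A', W ∪ B', hR, union_subset hUX (hA'.trans sdiff_subset),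
        union_subset hWY (hB'.trans sdiff_subset), hUW.union (hj.tileable hA's hB's) d1 d2,
        disjoint_union_left.2 ⟨hUR, hAdis.1.mono_left hA'⟩,
        disjoint_union_left.2 ⟨hWR, hBdis.1.mono_left hB'⟩, ?_, ?_⟩
      · rw [card_union_of_disjoint d1, hA's]; lia
      · rw [card_union_of_disjoint d1, hA's]; lia
    · have hp1 := fst_subset_cov₁ hp
      have hp2 := snd_subset_cov₂ hp
      have hc1 := hR.card₁ p hp
      have hc2 := hR.card₂ p hp
      have dA : Disjoint A p.1 := hAdis.1.mono_right hp1
      have dB : Disjoint B p.2 := hBdis.1.mono_right hp2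
      have dU : Disjoint U p.1 := hUR.mono_right hp1
      have dW : Disjoint W p.2 := hWR.mono_right hp2
      have t1 : Tileable G s (p.1 \ P') (p.2 \ Q') := by
        refine ((hR.joined p hp).mono sdiff_subset sdiff_subset).tileable_mul (r - 1) ?_ ?_
        · rw [card_sdiff_of_subset hP', hc1, hP's, Nat.sub_mul, one_mul]
        · rw [card_sdiff_of_subset hQ', hc2, hQ's, Nat.sub_mul, one_mul]
      have t2 := t1.union (hj'.tileable hP's hB's) sdiff_disjoint
        ((dB.mono hB' sdiff_subset).symm)
      rw [sdiff_union_of_subset hP'] at t2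
      have t3 := t2.union (hj.tileable hA's hQ's) (dA.mono_left hA').symm
        (disjoint_union_left.2 ⟨sdiff_disjoint, dB.mono hB' hQ'⟩)
      have hQB : p.2 \ Q' ∪ B' ∪ Q' = p.2 ∪ B' := by
        rw [union_right_comm, sdiff_union_of_subset hQ']
      rw [hQB] at t3
      have d1 : Disjoint U (p.1 ∪ A') :=
        disjoint_union_right.2 ⟨dU, (hAdis.2.mono_left hA').symm⟩
      have d2 : Disjoint W (p.2 ∪ B') :=
        disjoint_union_right.2 ⟨dW, (hBdis.2.mono_left hB').symm⟩
      have hcU : (U ∪ (p.1 ∪ A')).card = U.card + (r * s + s) := by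
        rw [card_union_of_disjoint d1, card_union_of_disjoint (dA.mono_left hA').symm, hc1, hA's]
      have hcR : (R.erase p).card + 1 = R.card := card_erase_add_one hp
      have hE₁ : cov₁ (R.erase p) ⊆ cov₁ R := cov₁_mono (erase_subset p R)
      have hE₂ : cov₂ (R.erase p) ⊆ cov₂ R := cov₂_mono (erase_subset p R)
      refine ⟨R.erase p, U ∪ (p.1 ∪ A'), W ∪ (p.2 ∪ B'), hR.subset (erase_subset p R),
        union_subset hUX (union_subset (hR.sub₁ p hp) (hA'.trans sdiff_subset)),
        union_subset hWY (union_subset (hR.sub₂ p hp) (hB'.trans sdiff_subset)),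
        hUW.union t3 d1 d2, ?_, ?_, ?_, ?_⟩
      · refine disjoint_union_left.2 ⟨hUR.mono_right hE₁, disjoint_union_left.2 ⟨?_,
          hAdis.1.mono hA' hE₁⟩⟩
        exact (disjoint_biUnion_right _ _ _).2 fun q hq =>
          hR.disj₁ p hp q (mem_of_mem_erase hq) (ne_of_mem_erase hq).symm
      · refine disjoint_union_left.2 ⟨hWR.mono_right hE₂, disjoint_union_left.2 ⟨?_,
          hBdis.1.mono hB' hE₂⟩⟩
        exact (disjoint_biUnion_right _ _ _).2 fun q hq =>
          hR.disj₂ p hp q (mem_of_mem_erase hq) (ne_of_mem_erase hq).symm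
      · rw [hcU]; lia
      · rw [hcU]
        have : R.card * (r * s) = (R.erase p).card * (r * s) + r * s := by rw [← hcR]; ring
        lia

lemma exists_almost_tiling_aux {γ : ℝ} (hγ : 0 < γ) (r : ℕ) (hr : 8 ≤ γ * r) (j : ℕ) :
    ∀ s : ℕ, 0 < s → ∃ n₀ : ℕ, ∀ (V : Type) (G : SimpleGraph V) (X Y : Finset V) (n : ℕ), n₀ ≤ n →
      X.card = n → Y.card = n →
      (∀ x ∈ X, (n : ℝ) / 2 ≤ degIn G x Y) → (∀ y ∈ Y, (n : ℝ) / 2 ≤ degIn G y X) →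
      ∃ A ⊆ X, ∃ B ⊆ Y, Tileable G s A B ∧
        ((n : ℝ) - γ * n ≤ A.card ∨ j * (γ ^ 2 / (256 * r) * n) ≤ A.card) := by
  have hr0 : 0 < r := by
    rcases Nat.eq_zero_or_pos r with rfl | h
    · norm_num at hr
    · exact h
  have hr1 : (1 : ℝ) ≤ r := by exact_mod_cast hr0
  induction j with
  | zero =>
    exact fun s _ => ⟨0, fun V G X Y n _ _ _ _ _ => ⟨∅, empty_subset _, ∅, empty_subset _,
      Tileable.empty G s, Or.inr (by simp)⟩⟩
  | succ j ih =>
    intro s hs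
    obtain ⟨n₁, hn₁⟩ := ih (r * s) (by positivity)
    obtain ⟨n₂, hn₂⟩ := exists_improvement s r hγ hr
    refine ⟨n₁ + n₂ + ⌈256 * (r * s) / γ ^ 2⌉₊, fun V G X Y n hn hX hY hdX hdY => ?_⟩
    have hnb : 256 * (r * s) / γ ^ 2 ≤ n := (Nat.le_ceil _).trans (by exact_mod_cast (by lia))
    rw [div_le_iff₀ (by positivity)] at hnb
    obtain ⟨A, hA, B, hB, hT, h | h⟩ := hn₁ V G X Y n (by lia) hX hY hdX hdY
    · exact ⟨A, hA, B, hB, hT.refine, Or.inl h⟩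
    obtain ⟨R₀, hR₀, rfl, rfl⟩ := hT
    have hs1 : (1 : ℝ) ≤ s := by exact_mod_cast hs
    set k : ℕ := ⌊γ ^ 2 * n / (64 * (r * s + s))⌋₊ with hk
    have hk1 : (k : ℝ) ≤ γ ^ 2 * n / (64 * (r * s + s)) := Nat.floor_le (by positivity)
    have hk2 : γ ^ 2 * n / (64 * (r * s + s)) < k + 1 := Nat.lt_floor_add_one _
    rw [le_div_iff₀ (by positivity)] at hk1
    rw [div_lt_iff₀ (by positivity)] at hk2
    rcases hn₂ V G X Y n (by lia) hX hY hdX hdY R₀ (hR₀.mono hA hB) k (by linarith) with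
      ⟨A', hA', B', hB', hT', h'⟩ | ⟨R, U, W, hR, hUX, hWY, hUW, hUR, hWR, -, hcard⟩
    · exact ⟨A', hA', B', hB', hT', Or.inl h'⟩
    refine ⟨cov₁ R ∪ U, union_subset hR.cov₁_subset hUX, cov₂ R ∪ W,
      union_subset hR.cov₂_subset hWY, hR.tileable.refine.union hUW hUR.symm hWR.symm,
      Or.inr ?_⟩
    rw [card_union_of_disjoint hUR.symm, hR.card_cov₁, hcard, ← hR₀.card_cov₁]
    push_cast
    have : γ ^ 2 / (256 * r) * n ≤ k * s := by
      rw [div_mul_eq_mul_div, div_le_iff₀ (by positivity)]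
      have e1 : (r * s + s : ℝ) ≤ 2 * (r * s) := by nlinarith
      have e2 : γ ^ 2 * n ≤ (k + 1) * (64 * (2 * (r * s))) := by
        refine hk2.le.trans ?_
        gcongr
      nlinarith
    linarith

/-- Bipartite graphs with minimum degree at least `n / 2` have almost perfect
`K_{t,t}`-tilings. -/
lemma exists_almost_tiling (t : ℕ) (ht : 0 < t) {γ : ℝ} (hγ : 0 < γ) :
    ∃ n₀ : ℕ, ∀ (V : Type) (G : SimpleGraph V) (X Y : Finset V) (n : ℕ), n₀ ≤ n →
      X.card = n → Y.card = n →
      (∀ x ∈ X, (n : ℝ) / 2 ≤ degIn G x Y) → (∀ y ∈ Y, (n : ℝ) / 2 ≤ degIn G y X) →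
      ∃ R, IsTiling G X Y t R ∧ (n : ℝ) - γ * n ≤ R.card * t := by
  obtain ⟨r, hr⟩ := exists_nat_ge (8 / γ)
  rw [div_le_iff₀' hγ] at hr
  have hr0 : (0 : ℝ) < r := by
    by_contra! h
    nlinarith
  obtain ⟨j, hj⟩ := exists_nat_ge (1 / (γ ^ 2 / (256 * r)))
  rw [div_le_iff₀ (by positivity)] at hj
  obtain ⟨n₀, hn₀⟩ := exists_almost_tiling_aux hγ r hr j t ht
  refine ⟨n₀, fun V G X Y n hn hX hY hdX hdY => ?_⟩
  obtain ⟨A, hA, B, hB, ⟨R, hR, rfl, rfl⟩, h⟩ := hn₀ V G X Y n hn hX hY hdX hdY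
  rw [hR.card_cov₁] at h
  push_cast at h
  refine ⟨R, hR.mono hA hB, h.elim id fun h => le_trans ?_ h⟩
  have h1 : (n : ℝ) * 1 ≤ n * (j * (γ ^ 2 / (256 * r))) := by gcongr
  have h2 : 0 ≤ γ * n := by positivity
  linarith

/-- A completely joined pair stays tileable after adding few vertices, each of which has many
neighbours on the opposite side. -/
lemma Joined.tileable_union {G : SimpleGraph V} {m : ℕ} (hm : 0 < m) (N : ℕ) :
    ∀ {P Q S T : Finset V}, Joined G P Q → Disjoint P S → Disjoint Q T → S.card + T.card = N →
      m * N ≤ P.card → m * N ≤ Q.card → (∀ s ∈ S, m * N ≤ degIn G s Q) →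
      (∀ t ∈ T, m * N ≤ degIn G t P) → P.card + S.card = Q.card + T.card →
      m ∣ P.card + S.card → Tileable G m (P ∪ S) (Q ∪ T) := by
  induction N with
  | zero =>
    intro P Q S T h _ _ hN _ _ _ _ he hd
    have hS : S = ∅ := card_eq_zero.1 (by lia)
    have hT : T = ∅ := card_eq_zero.1 (by lia)
    subst hS hT
    simp only [card_empty, add_zero] at he hd
    obtain ⟨k, hk⟩ := hd
    rw [union_empty, union_empty]
    exact h.tileable_mul k (by rw [hk, mul_comm]) (by rw [← he, hk, mul_comm])
  | succ N ih =>
    have key : ∀ {P Q S T : Finset V}, S.Nonempty → Joined G P Q → Disjoint P S → Disjoint Q T →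
        S.card + T.card = N + 1 →
        m * (N + 1) ≤ P.card → m * (N + 1) ≤ Q.card → (∀ s ∈ S, m * (N + 1) ≤ degIn G s Q) →
        (∀ t ∈ T, m * (N + 1) ≤ degIn G t P) → P.card + S.card = Q.card + T.card →
        m ∣ P.card + S.card → Tileable G m (P ∪ S) (Q ∪ T) := by
      rintro P Q S T ⟨s, hs⟩ h hPS hQT hN hP hQ hS hT he hd
      rw [mul_add, mul_one] at hP hQ
      simp only [mul_add, mul_one] at hS hT
      obtain ⟨Q', hQ', hQc⟩ := exists_subset_card_eq (show m ≤ degIn G s Q by have := hS s hs; lia)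
      obtain ⟨P', hP', hPc⟩ := exists_subset_card_eq (show m - 1 ≤ P.card by lia)
      have hQ'' : Q' ⊆ Q := hQ'.trans (filter_subset _ _)
      have hsP : s ∉ P := fun hp => disjoint_left.1 hPS hp hs
      have hsc : (S.erase s).card + 1 = S.card := card_erase_add_one hs
      have hPd : (P \ P').card + (m - 1) = P.card := by
        rw [card_sdiff_of_subset hP']; lia
      have hQd : (Q \ Q').card + m = Q.card := by
        rw [card_sdiff_of_subset hQ'']; lia
      have h1 : Tileable G m (insert s P') Q' := by
        refine Joined.tileable ?_ ?_ hQc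
        · intro x hx y hy
          rcases mem_insert.1 hx with rfl | hx
          · exact (mem_filter.1 (hQ' hy)).2
          · exact h x (hP' hx) y (hQ'' hy)
        · rw [card_insert_of_notMem fun hp => hsP (hP' hp)]; lia
      have h2 : Tileable G m (P \ P' ∪ S.erase s) (Q \ Q' ∪ T) := by
        refine ih (h.mono sdiff_subset sdiff_subset)
          (hPS.mono sdiff_subset (erase_subset _ _)) (hQT.mono_left sdiff_subset)
          (by lia) (by lia) (by lia) (fun v hv => ?_) (fun v hv => ?_) (by lia) ?_
        · have a := hS v (mem_of_mem_erase hv)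
          have b := degIn_le_add_sdiff G v Q (Q \ Q')
          rw [Finset.sdiff_sdiff_eq_self hQ''] at b
          lia
        · have a := hT v hv
          have b := degIn_le_add_sdiff G v P (P \ P')
          rw [Finset.sdiff_sdiff_eq_self hP'] at b
          lia
        · refine (Nat.dvd_add_left (dvd_refl m)).1 ?_
          convert hd using 1
          lia
      have h3 := h1.union h2
        (by
          rw [disjoint_insert_left, disjoint_union_right]
          refine ⟨?_, disjoint_sdiff, hPS.mono hP' (erase_subset _ _)⟩
          simp [hsP])
        (by
          rw [disjoint_union_right]
          exact ⟨disjoint_sdiff, hQT.mono_left hQ''⟩)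
      convert h3 using 1
      · rw [insert_union, ← union_assoc, union_sdiff_of_subset hP', ← union_insert,
          insert_erase hs]
      · rw [← union_assoc, union_sdiff_of_subset hQ'']
    intro P Q S T h hPS hQT hN hP hQ hS hT he hd
    rcases S.eq_empty_or_nonempty with hS0 | hS0
    · have hT0 : T.Nonempty := by
        rw [← card_pos]; subst hS0; simp at hN; lia
      exact (key hT0 h.symm hQT hPS (by lia) hQ hP hT hS he.symm (he ▸ hd)).swap
    · exact key hS0 h hPS hQT hN hP hQ hS hT he hd

/-- `(f i, g i)`, for `i ∈ R`, is a family of disjoint copies of `K_{t,t}`, with first classes in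
`X` and second classes in `Y`. -/
structure IsFamily {ι : Type*} (G : SimpleGraph V) (X Y : Finset V) (t : ℕ) (R : Finset ι)
    (f g : ι → Finset V) : Prop where
  sub₁ : ∀ i ∈ R, f i ⊆ X
  sub₂ : ∀ i ∈ R, g i ⊆ Y
  card₁ : ∀ i ∈ R, (f i).card = t
  card₂ : ∀ i ∈ R, (g i).card = t
  joined : ∀ i ∈ R, Joined G (f i) (g i)
  disj₁ : ∀ i ∈ R, ∀ j ∈ R, i ≠ j → Disjoint (f i) (f j)
  disj₂ : ∀ i ∈ R, ∀ j ∈ R, i ≠ j → Disjoint (g i) (g j)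

lemma IsFamily.swap {ι : Type*} {G : SimpleGraph V} {X Y : Finset V} {t : ℕ} {R : Finset ι}
    {f g : ι → Finset V} (h : IsFamily G X Y t R f g) : IsFamily G Y X t R g f :=
  ⟨h.sub₂, h.sub₁, h.card₂, h.card₁, fun i hi => (h.joined i hi).symm, h.disj₂, h.disj₁⟩

lemma IsFamily.subset {ι : Type*} {G : SimpleGraph V} {X Y : Finset V} {t : ℕ} {R R' : Finset ι}
    {f g : ι → Finset V} (h : IsFamily G X Y t R f g) (hR : R' ⊆ R) :
    IsFamily G X Y t R' f g where
  sub₁ p hp := h.sub₁ p (hR hp)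
  sub₂ p hp := h.sub₂ p (hR hp)
  card₁ p hp := h.card₁ p (hR hp)
  card₂ p hp := h.card₂ p (hR hp)
  joined p hp := h.joined p (hR hp)
  disj₁ p hp q hq := h.disj₁ p (hR hp) q (hR hq)
  disj₂ p hp q hq := h.disj₂ p (hR hp) q (hR hq)

lemma IsTiling.isFamily {G : SimpleGraph V} {X Y : Finset V} {t : ℕ}
    {R : Finset (Finset V × Finset V)} (h : IsTiling G X Y t R) :
    IsFamily G X Y t R Prod.fst Prod.snd :=
  ⟨h.sub₁, h.sub₂, h.card₁, h.card₂, h.joined, h.disj₁, h.disj₂⟩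

lemma IsFamily.card_biUnion {ι : Type*} {G : SimpleGraph V} {X Y : Finset V} {t : ℕ}
    {R : Finset ι} {f g : ι → Finset V} (h : IsFamily G X Y t R f g) :
    (R.biUnion f).card = R.card * t := by
  rw [Finset.card_biUnion (fun p hp q hq hpq => h.disj₁ p hp q hq hpq),
    Finset.sum_const_nat h.card₁]

lemma IsFamily.biUnion_subset {ι : Type*} {G : SimpleGraph V} {X Y : Finset V} {t : ℕ}
    {R : Finset ι} {f g : ι → Finset V} (h : IsFamily G X Y t R f g) : R.biUnion f ⊆ X :=
  Finset.biUnion_subset.2 h.sub₁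

/-- The bipartite graph between `X` and `Y` has no large sparse pair. -/
def NoSparsePair (G : SimpleGraph V) (X Y : Finset V) (n : ℕ) (c : ℝ) : Prop :=
  ∀ A ⊆ X, ∀ B ⊆ Y, (1 / 2 - c) * n ≤ A.card → (1 / 2 - c) * n ≤ B.card →
    c * n ^ 2 ≤ ∑ a ∈ A, (degIn G a B : ℝ)

lemma NoSparsePair.swap {G : SimpleGraph V} {X Y : Finset V} {n : ℕ} {c : ℝ}
    (h : NoSparsePair G X Y n c) : NoSparsePair G Y X n c := by
  intro A hA B hB hAc hBc
  have := h B hB A hA hBc hAc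
  have h2 : ∑ a ∈ A, (degIn G a B : ℝ) = ∑ b ∈ B, (degIn G b A : ℝ) := by
    exact_mod_cast sum_degIn_comm G A B
  rwa [h2]

lemma exists_route {ι : Type*} {G : SimpleGraph V} {X Y : Finset V} {n m t K : ℕ} {c : ℝ}
    {R : Finset ι} {f g : ι → Finset V} (h : IsFamily G X Y t R f g) (hm : 0 < m) (hmt : m ∣ t)
    (hmt' : 2 * m ≤ t) (hmK : m ≤ K) (hc : 0 < c) (hKt : (K : ℝ) ≤ c / 4 * t)
    (hn : (t : ℝ) < c / 2 * n)
    (hX : X.card = n) (hY : Y.card = n) (hdX : ∀ x ∈ X, (n : ℝ) / 2 ≤ degIn G x Y)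
    (hdY : ∀ y ∈ Y, (n : ℝ) / 2 ≤ degIn G y X) (hG : NoSparsePair G X Y n c)
    (hR : (1 - c / 4) * n ≤ R.card * t) {Q : Finset V} (hQ : Q ⊆ Y) (hQt : Q.card = t)
    {v : V} (hv : v ∈ X) (hvR : v ∉ R.biUnion f) :
    ∃ i ∈ R, ∃ j ∈ R, i ≠ j ∧ ∃ p ∈ f j, K ≤ degIn G p Q ∧
      Tileable G m (insert v ((f i ∪ f j).erase p)) (g i ∪ g j) := by
  have hn0 : (0 : ℝ) < n := by
    have : (0 : ℝ) ≤ t := by positivity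
    by_contra! hle
    nlinarith
  have ht0 : (0 : ℝ) < t := by exact_mod_cast (by lia : 0 < t)
  have hcR : R.card * t ≤ n := by
    rw [← h.card_biUnion, ← hX]; exact card_le_card h.biUnion_subset
  have hcR' : (R.card : ℝ) * t ≤ n := by exact_mod_cast hcR
  set J := R.filter fun i => (K : ℝ) ≤ degIn G v (g i) with hJ
  set N := R.filter fun i => ∃ p ∈ f i, K ≤ degIn G p Q with hN
  have hJR : J ⊆ R := filter_subset _ _
  have hNR : N ⊆ R := filter_subset _ _
  have hJc : (1 / 2 - c) * n ≤ (J.card : ℝ) * t := by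
    have h1 : (degIn G v Y : ℝ) ≤ ∑ i ∈ R, (degIn G v (g i) : ℝ) + (n - R.card * t) := by
      have a := degIn_le_add_sdiff G v Y (R.biUnion g)
      rw [card_sdiff_of_subset h.swap.biUnion_subset, h.swap.card_biUnion, hY] at a
      have b := degIn_biUnion_le G v R g
      have d : degIn G v Y ≤ ∑ i ∈ R, degIn G v (g i) + (n - R.card * t) := by lia
      rw [← Nat.cast_le (α := ℝ)] at d
      push_cast [Nat.cast_sub hcR] at d
      exact d
    have h2 := card_filter_mul_add_ge R (fun i => (degIn G v (g i) : ℝ)) (M := t) (c := K)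
      (by positivity) (fun i hi => by
        have := degIn_le_card G v (g i)
        rw [h.card₂ i hi] at this
        exact_mod_cast this)
    have h3 := hdX v hv
    have h4 : (R.card : ℝ) * K ≤ c / 4 * n := by
      calc (R.card : ℝ) * K ≤ R.card * (c / 4 * t) := by gcongr
        _ = c / 4 * (R.card * t) := by ring
        _ ≤ _ := by gcongr
    rw [← hJ] at h2
    nlinarith
  have hNc : (1 / 2 - c) * n ≤ (N.card : ℝ) * t := by
    set D := X.filter fun x => (K : ℝ) ≤ degIn G x Q with hD
    have h1 := card_filter_mul_add_ge X (fun x => (degIn G x Q : ℝ)) (M := t) (c := K)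
      (by positivity) (fun x _ => by
        have := degIn_le_card G x Q
        rw [hQt] at this
        exact_mod_cast this)
    rw [← hD, hX] at h1
    have h2 : (t : ℝ) * (n / 2) ≤ ∑ x ∈ X, (degIn G x Q : ℝ) := by
      have : ∑ x ∈ X, (degIn G x Q : ℝ) = ∑ q ∈ Q, (degIn G q X : ℝ) := by
        exact_mod_cast sum_degIn_comm G X Q
      rw [this, ← hQt, ← nsmul_eq_mul]
      exact card_nsmul_le_sum _ _ _ fun q hq => hdY q (hQ hq)
    have h3 : D ⊆ (X \ R.biUnion f) ∪ N.biUnion f := by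
      intro x hx
      obtain ⟨hxX, hxK⟩ := mem_filter.1 hx
      by_cases hxR : x ∈ R.biUnion f
      · obtain ⟨i, hi, hxi⟩ := mem_biUnion.1 hxR
        exact mem_union_right _ (mem_biUnion.2
          ⟨i, mem_filter.2 ⟨hi, x, hxi, by exact_mod_cast hxK⟩, hxi⟩)
      · exact mem_union_left _ (mem_sdiff.2 ⟨hxX, hxR⟩)
    have h4 : (D.card : ℝ) ≤ (n - R.card * t) + N.card * t := by
      have a := (card_le_card h3).trans (card_union_le _ _)
      rw [card_sdiff_of_subset h.biUnion_subset, h.card_biUnion, (h.subset hNR).card_biUnion,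
        hX, ← Nat.cast_le (α := ℝ)] at a
      push_cast [Nat.cast_sub hcR] at a
      exact a
    have h5 : (1 / 2 - c / 4) * n ≤ D.card := by
      have : (1 / 2 - c / 4) * n * t ≤ D.card * t := by nlinarith
      exact le_of_mul_le_mul_right this ht0
    nlinarith
  obtain ⟨i, hi, p, hp, j, hj, hij, hpj⟩ : ∃ i ∈ J, ∃ p ∈ f i, ∃ j ∈ N, i ≠ j ∧
      K ≤ degIn G p (g j) := by
    by_contra! hcon
    have h1 := hG (J.biUnion f) (h.subset hJR).biUnion_subset (N.biUnion g)
      (h.subset hNR).swap.biUnion_subset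
      (by rw [(h.subset hJR).card_biUnion]; exact_mod_cast hJc)
      (by rw [(h.subset hNR).swap.card_biUnion]; exact_mod_cast hNc)
    have h2 : ∀ a ∈ J.biUnion f, (degIn G a (N.biUnion g) : ℝ) ≤ c / 4 * n + t := by
      intro a ha
      obtain ⟨i, hi, hai⟩ := mem_biUnion.1 ha
      have b1 := degIn_biUnion_le G a N g
      have b2 : ∑ j ∈ N, degIn G a (g j) ≤ N.card * K + t := by
        calc ∑ j ∈ N, degIn G a (g j) ≤ ∑ j ∈ N, (K + if j = i then t else 0) := by
              refine sum_le_sum fun j hj => ?_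
              split_ifs with hji
              · have := degIn_le_card G a (g j)
                rw [h.card₂ j (hNR hj)] at this
                lia
              · have := hcon i hi a hai j hj (Ne.symm hji)
                lia
          _ = N.card * K + ∑ j ∈ N, if j = i then t else 0 := by
              rw [sum_add_distrib, sum_const, smul_eq_mul]
          _ ≤ _ := by
              gcongr
              rw [sum_ite_eq']
              split_ifs <;> lia
      have b3 : (degIn G a (N.biUnion g) : ℝ) ≤ N.card * K + t := by exact_mod_cast b1.trans b2
      have b4 : (N.card : ℝ) * K ≤ c / 4 * n := by
        calc (N.card : ℝ) * K ≤ R.card * (c / 4 * t) := by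
              gcongr
          _ = c / 4 * (R.card * t) := by ring
          _ ≤ _ := by gcongr
      linarith
    have h3 := sum_le_card_nsmul _ _ _ h2
    rw [nsmul_eq_mul, (h.subset hJR).card_biUnion] at h3
    have h4 : ((J.card * t : ℕ) : ℝ) ≤ n := by
      refine le_trans ?_ hcR'
      push_cast
      gcongr
    have h5 : ((J.card * t : ℕ) : ℝ) * (c / 4 * n + t) ≤ n * (c / 4 * n + t) := by gcongr
    have h6 : n * (c / 4 * n + t) < n * (c * n) := by
      gcongr
      nlinarith
    nlinarith
  obtain ⟨hjR, q, hq, hqQ⟩ := mem_filter.1 hj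
  obtain ⟨hiR, hvi⟩ := mem_filter.1 hi
  have hvi : K ≤ degIn G v (g i) := by exact_mod_cast hvi
  refine ⟨i, hiR, j, hjR, hij, q, hq, hqQ, ?_⟩
  have hvf : ∀ i ∈ R, v ∉ f i := fun i hi hvi => hvR (mem_biUnion.2 ⟨i, hi, hvi⟩)
  have hfd := h.disj₁ i hiR j hjR hij
  have hgd := h.disj₂ i hiR j hjR hij
  have hpfj : p ∉ f j := fun hp' => disjoint_left.1 hfd hp hp'
  have hqfi : q ∉ f i := fun hp' => disjoint_left.1 hfd hp' hq
  have e1 := card_erase_add_one hp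
  have e2 := card_erase_add_one hq
  rw [h.card₁ i hiR] at e1
  rw [h.card₁ j hjR] at e2
  have h1 : Tileable G m ((f i).erase p ∪ {v}) (g i ∪ ∅) := by
    refine ((h.joined i hiR).mono (erase_subset _ _) subset_rfl).tileable_union hm 1 ?_
      (disjoint_empty_right _) (by simp) (by lia) (by rw [h.card₂ i hiR]; lia) ?_ (by simp) ?_ ?_
    · exact disjoint_singleton_right.2 fun hv => hvf i hiR (mem_of_mem_erase hv)
    · simp only [mem_singleton, forall_eq]; lia
    · rw [card_singleton, card_empty, h.card₂ i hiR]; lia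
    · rwa [card_singleton, e1]
  have h2 : Tileable G m ((f j).erase q ∪ {p}) (g j ∪ ∅) := by
    refine ((h.joined j hjR).mono (erase_subset _ _) subset_rfl).tileable_union hm 1 ?_
      (disjoint_empty_right _) (by simp) (by lia) (by rw [h.card₂ j hjR]; lia) ?_ (by simp) ?_ ?_
    · exact disjoint_singleton_right.2 fun hv => hpfj (mem_of_mem_erase hv)
    · simp only [mem_singleton, forall_eq]; lia
    · rw [card_singleton, card_empty, h.card₂ j hjR]; lia
    · rwa [card_singleton, e2]
  rw [union_empty] at h1 h2
  have h3 := h1.union h2 ?_ hgd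
  · convert h3 using 1
    ext x
    simp only [mem_insert, mem_erase, mem_union, mem_singleton]
    have hvj := hvf j hjR
    have hvi' := hvf i hiR
    grind
  · rw [disjoint_left]
    intro x
    simp only [mem_erase, mem_union, mem_singleton]
    have hvj := hvf j hjR
    have hvi' := hvf i hiR
    have := fun hx : x ∈ f i => disjoint_left.1 hfd hx
    grind

lemma exists_exchange {ι : Type*} {G : SimpleGraph V} {X Y : Finset V} {m t K M : ℕ}
    {R₀ : Finset ι} {f g : ι → Finset V} {Q : Finset V} (h : IsFamily G X Y t R₀ f g)
    (hroute : ∀ R ⊆ R₀, M ≤ R.card → ∀ v ∈ X, v ∉ R₀.biUnion f →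
      ∃ i ∈ R, ∃ j ∈ R, i ≠ j ∧ ∃ p ∈ f j, K ≤ degIn G p Q ∧
        Tileable G m (insert v ((f i ∪ f j).erase p)) (g i ∪ g j)) (S : Finset V) :
    S ⊆ X → Disjoint S (R₀.biUnion f) → ∀ R ⊆ R₀, M + 2 * S.card ≤ R.card →
      ∃ R' ⊆ R, R'.card + 2 * S.card = R.card ∧ ∃ S' ⊆ (R \ R').biUnion f, S'.card = S.card ∧
        (∀ s ∈ S', K ≤ degIn G s Q) ∧
        Tileable G m (S ∪ ((R \ R').biUnion f \ S')) ((R \ R').biUnion g) := by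
  induction S using Finset.induction_on with
  | empty =>
    intro _ _ R hR _
    exact ⟨R, subset_rfl, by simp, ∅, by simp, by simp, by simp, by simpa using .empty G m⟩
  | insert v S hvS ih =>
    intro hS hSd R hR hc
    rw [card_insert_of_notMem hvS] at hc
    rw [disjoint_insert_left] at hSd
    obtain ⟨i, hi, j, hj, hij, p, hp, hpQ, hT⟩ := hroute R hR (by lia) v
      (hS (mem_insert_self v S)) hSd.1
    have hR1 : (R \ {i, j}).card + 2 = R.card := by
      have := card_sdiff_add_card_eq_card (s := {i, j}) (t := R) (by
        intro k hk
        rcases mem_insert.1 hk with rfl | hk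
        · exact hi
        · rwa [mem_singleton.1 hk])
      rwa [card_pair hij] at this
    obtain ⟨R', hR', hRc, S', hS', hSc, hSQ, hT'⟩ := ih ((subset_insert v S).trans hS) hSd.2
      (R \ {i, j}) (sdiff_subset.trans hR) (by lia)
    have hRR : R \ R' = {i, j} ∪ ((R \ {i, j}) \ R') := by
      ext k
      simp only [mem_sdiff, mem_union, mem_insert, mem_singleton]
      have h1 : k ∈ R' → k ∈ R ∧ k ≠ i ∧ k ≠ j := fun hk => by
        have := hR' hk
        simpa only [mem_sdiff, mem_insert, mem_singleton, not_or] using this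
      grind
    set R₂ := (R \ {i, j}) \ R' with hR₂
    have hR₂' : ∀ k ∈ R₂, k ∈ R₀ ∧ k ≠ i ∧ k ≠ j := by
      intro k hk
      simp only [hR₂, mem_sdiff, mem_insert, mem_singleton, not_or] at hk
      exact ⟨hR hk.1.1, hk.1.2⟩
    have hif : Disjoint (f i) (R₂.biUnion f) := (disjoint_biUnion_right _ _ _).2 fun k hk =>
      h.disj₁ i (hR hi) k (hR₂' k hk).1 (hR₂' k hk).2.1.symm
    have hjf : Disjoint (f j) (R₂.biUnion f) := (disjoint_biUnion_right _ _ _).2 fun k hk =>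
      h.disj₁ j (hR hj) k (hR₂' k hk).1 (hR₂' k hk).2.2.symm
    have hig : Disjoint (g i) (R₂.biUnion g) := (disjoint_biUnion_right _ _ _).2 fun k hk =>
      h.disj₂ i (hR hi) k (hR₂' k hk).1 (hR₂' k hk).2.1.symm
    have hjg : Disjoint (g j) (R₂.biUnion g) := (disjoint_biUnion_right _ _ _).2 fun k hk =>
      h.disj₂ j (hR hj) k (hR₂' k hk).1 (hR₂' k hk).2.2.symm
    have hfi : f i ⊆ R₀.biUnion f := subset_biUnion_of_mem f (hR hi)
    have hfj : f j ⊆ R₀.biUnion f := subset_biUnion_of_mem f (hR hj)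
    have hf2 : R₂.biUnion f ⊆ R₀.biUnion f :=
      biUnion_subset_biUnion_of_subset_left f fun k hk => (hR₂' k hk).1
    have hpd : p ∉ R₂.biUnion f := disjoint_left.1 hjf hp
    have hSd2 := disjoint_left.1 hSd.2
    refine ⟨R', hR'.trans sdiff_subset, ?_, insert p S', ?_, ?_, ?_, ?_⟩
    · rw [card_insert_of_notMem hvS]; lia
    · rw [hRR, union_biUnion, biUnion_insert, singleton_biUnion]
      refine insert_subset (mem_union_left _ (mem_union_right _ hp)) (hS'.trans ?_)
      exact subset_union_right
    · rw [card_insert_of_notMem hvS, card_insert_of_notMem fun hp => hpd (hS' hp), hSc]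
    · simpa [hpQ] using hSQ
    · rw [hRR, union_biUnion, union_biUnion, biUnion_insert, singleton_biUnion, biUnion_insert,
        singleton_biUnion]
      have := hT.union hT' ?_ ?_
      · convert this using 1
        ext x
        have a1 := fun hx : x ∈ f i => disjoint_left.1 hif hx
        have a2 := fun hx : x ∈ f j => disjoint_left.1 hjf hx
        have a3 := fun hx : x ∈ S' => hS' hx
        simp only [mem_insert, mem_union, mem_sdiff, mem_erase]
        grind
      · rw [disjoint_left]
        intro x
        have a1 := fun hx : x ∈ f i => disjoint_left.1 hif hx
        have a2 := fun hx : x ∈ f j => disjoint_left.1 hjf hx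
        have a3 := fun hx : x ∈ f i => hfi hx
        have a4 := fun hx : x ∈ f j => hfj hx
        have a5 := fun hx : x ∈ R₂.biUnion f => hf2 hx
        have a6 := fun hx : x ∈ S => hSd2 hx
        have a7 := hSd.1
        simp only [mem_insert, mem_union, mem_sdiff, mem_erase]
        grind
      · exact disjoint_union_left.2 ⟨hig, hjg⟩

/-- Absorbing `m` uncovered vertices on each side. -/
lemma exists_absorb {ι : Type*} {G : SimpleGraph V} {X Y : Finset V} {m t M : ℕ}
    {R₀ : Finset ι} {f g : ι → Finset V} (h : IsFamily G X Y t R₀ f g) (hm : 0 < m)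
    (hmt : m ∣ t) (hmt' : 2 * m ^ 2 ≤ t)
    (hroute : ∀ Q ⊆ Y, Q.card = t → ∀ R ⊆ R₀, M ≤ R.card → ∀ v ∈ X, v ∉ R₀.biUnion f →
      ∃ i ∈ R, ∃ j ∈ R, i ≠ j ∧ ∃ p ∈ f j, 2 * m ^ 2 ≤ degIn G p Q ∧
        Tileable G m (insert v ((f i ∪ f j).erase p)) (g i ∪ g j))
    (hroute' : ∀ Q ⊆ X, Q.card = t → ∀ R ⊆ R₀, M ≤ R.card → ∀ v ∈ Y, v ∉ R₀.biUnion g →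
      ∃ i ∈ R, ∃ j ∈ R, i ≠ j ∧ ∃ p ∈ g j, 2 * m ^ 2 ≤ degIn G p Q ∧
        Tileable G m (insert v ((g i ∪ g j).erase p)) (f i ∪ f j))
    {S T : Finset V} (hS : S ⊆ X) (hT : T ⊆ Y) (hSd : Disjoint S (R₀.biUnion f))
    (hTd : Disjoint T (R₀.biUnion g)) (hSc : S.card = m) (hTc : T.card = m)
    {R : Finset ι} (hR : R ⊆ R₀) (hRc : M + (4 * m + 1) ≤ R.card) :
    ∃ R' ⊆ R, R'.card + (4 * m + 1) = R.card ∧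
      Tileable G m (S ∪ (R \ R').biUnion f) (T ∪ (R \ R').biUnion g) := by
  obtain ⟨k, hk⟩ : R.Nonempty := by rw [← card_pos]; lia
  have hkc := card_erase_add_one hk
  have hkR := hR hk
  obtain ⟨R₁, hR₁, hc₁, S', hS', hSc', hSQ, hT1⟩ := exists_exchange h
    (hroute (g k) (h.sub₂ k hkR) (h.card₂ k hkR)) S hS hSd (R.erase k)
    ((erase_subset _ _).trans hR) (by lia)
  obtain ⟨R₂, hR₂, hc₂, T', hT', hTc', hTQ, hT2⟩ := exists_exchange h.swap
    (hroute' (f k) (h.sub₁ k hkR) (h.card₁ k hkR)) T hT hTd R₁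
    (hR₁.trans ((erase_subset _ _).trans hR)) (by lia)
  have hdisj : ∀ A B : Finset ι, A ⊆ R₀ → B ⊆ R₀ → Disjoint A B →
      Disjoint (A.biUnion f) (B.biUnion f) ∧ Disjoint (A.biUnion g) (B.biUnion g) := by
    intro A B hA hB hAB
    simp only [disjoint_biUnion_left, disjoint_biUnion_right]
    exact ⟨fun i hi j hj => h.disj₁ j (hA hj) i (hB hi)
      (by rintro rfl; exact disjoint_left.1 hAB hj hi),
      fun i hi j hj => h.disj₂ j (hA hj) i (hB hi) (by rintro rfl; exact disjoint_left.1 hAB hj hi)⟩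
  have hR₁k : k ∉ R₁ := fun hk' => notMem_erase k R (hR₁ hk')
  have hR₁R : R₁ ⊆ R := hR₁.trans (erase_subset _ _)
  have hRR : R \ R₂ = {k} ∪ ((R.erase k \ R₁) ∪ (R₁ \ R₂)) := by
    ext x
    have a1 := fun hx : x ∈ R₁ => hR₁ hx
    have a2 := fun hx : x ∈ R₂ => hR₂ hx
    simp only [mem_union, mem_sdiff, mem_erase, mem_singleton] at a1 ⊢
    grind
  set C := R.erase k \ R₁ with hC
  set D := R₁ \ R₂ with hD
  have hCR : C ⊆ R₀ := sdiff_subset.trans ((erase_subset _ _).trans hR)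
  have hDR : D ⊆ R₀ := sdiff_subset.trans (hR₁R.trans hR)
  have hkR' : {k} ⊆ R₀ := singleton_subset_iff.2 hkR
  obtain ⟨hCDf, hCDg⟩ := hdisj C D hCR hDR (disjoint_sdiff_self_left.mono_right sdiff_subset)
  obtain ⟨hkCf, hkCg⟩ := hdisj {k} C hkR' hCR (by simp [hC])
  obtain ⟨hkDf, hkDg⟩ := hdisj {k} D hkR' hDR (by simp [hD, hR₁k])
  rw [singleton_biUnion] at hkCf hkCg hkDf hkDg
  have hT3 : Tileable G m (f k ∪ S') (g k ∪ T') := by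
    have e : 2 * m ^ 2 = m * (m + m) := by ring
    refine (h.joined k hkR).tileable_union hm (m + m) (hkCf.mono_right hS')
      (hkDg.mono_right hT') (by lia) (by rw [h.card₁ k hkR]; lia) (by rw [h.card₂ k hkR]; lia)
      (fun s hs => by have := hSQ s hs; lia) (fun s hs => by have := hTQ s hs; lia)
      (by rw [h.card₁ k hkR, h.card₂ k hkR]; lia) ?_
    rw [h.card₁ k hkR, hSc', hSc]
    exact dvd_add hmt (dvd_refl m)
  have hSC := hSd.mono_right (biUnion_subset_biUnion_of_subset_left f hCR)
  have hSD := hSd.mono_right (biUnion_subset_biUnion_of_subset_left f hDR)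
  have hSk := hSd.mono_right (biUnion_subset_biUnion_of_subset_left f hkR')
  have hTC := hTd.mono_right (biUnion_subset_biUnion_of_subset_left g hCR)
  have hTD := hTd.mono_right (biUnion_subset_biUnion_of_subset_left g hDR)
  have hTk := hTd.mono_right (biUnion_subset_biUnion_of_subset_left g hkR')
  rw [singleton_biUnion] at hSk hTk
  refine ⟨R₂, hR₂.trans hR₁R, by lia, ?_⟩
  rw [hRR]
  simp only [union_biUnion, singleton_biUnion]
  generalize C.biUnion f = Cf at *
  generalize C.biUnion g = Cg at *
  generalize D.biUnion f = Df at *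
  generalize D.biUnion g = Dg at *
  generalize f k = fk at *
  generalize g k = gk at *
  have h5 := (hT1.union hT2.swap ?_ ?_).union hT3 ?_ ?_
  · convert h5 using 1
    · ext x
      have a := fun hx : x ∈ S' => hS' hx
      simp only [mem_union, mem_sdiff]
      grind
    · ext x
      have a := fun hx : x ∈ T' => hT' hx
      simp only [mem_union, mem_sdiff]
      grind
  · exact disjoint_union_left.2 ⟨hSD, hCDf.mono_left sdiff_subset⟩
  · exact disjoint_union_right.2 ⟨hTC.symm, hCDg.mono_right sdiff_subset⟩
  · simp only [disjoint_union_left, disjoint_union_right]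
    exact ⟨⟨⟨hSk, (hkCf.mono_right sdiff_subset).symm⟩, hkDf.symm⟩,
      ⟨hSC.mono_right hS', disjoint_sdiff_self_left⟩, (hCDf.mono_left hS').symm⟩
  · simp only [disjoint_union_left, disjoint_union_right]
    exact ⟨⟨hkCg.symm, hTk, (hkDg.mono_right sdiff_subset).symm⟩,
      hCDg.mono_right hT', hTD.mono_right hT', disjoint_sdiff_self_left⟩

lemma exists_absorb_iterate {ι : Type*} {G : SimpleGraph V} {X Y : Finset V} {n m t M : ℕ}
    {R₀ : Finset ι} {f g : ι → Finset V} (h : IsFamily G X Y t R₀ f g) (hm : 0 < m)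
    (hmt : m ∣ t) (hmt' : 2 * m ^ 2 ≤ t) (hX : X.card = n) (hY : Y.card = n)
    (hroute : ∀ Q ⊆ Y, Q.card = t → ∀ R ⊆ R₀, M ≤ R.card → ∀ v ∈ X, v ∉ R₀.biUnion f →
      ∃ i ∈ R, ∃ j ∈ R, i ≠ j ∧ ∃ p ∈ f j, 2 * m ^ 2 ≤ degIn G p Q ∧
        Tileable G m (insert v ((f i ∪ f j).erase p)) (g i ∪ g j))
    (hroute' : ∀ Q ⊆ X, Q.card = t → ∀ R ⊆ R₀, M ≤ R.card → ∀ v ∈ Y, v ∉ R₀.biUnion g →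
      ∃ i ∈ R, ∃ j ∈ R, i ≠ j ∧ ∃ p ∈ g j, 2 * m ^ 2 ≤ degIn G p Q ∧
        Tileable G m (insert v ((g i ∪ g j).erase p)) (f i ∪ f j)) (k : ℕ)
    (hk : k * m + R₀.card * t ≤ n) (hkM : M + k * (4 * m + 1) ≤ R₀.card) :
    ∃ S ⊆ X, ∃ T ⊆ Y, ∃ R ⊆ R₀, Disjoint S (R₀.biUnion f) ∧ Disjoint T (R₀.biUnion g) ∧
      S.card = k * m ∧ T.card = k * m ∧ R.card + k * (4 * m + 1) = R₀.card ∧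
      Tileable G m (S ∪ (R₀ \ R).biUnion f) (T ∪ (R₀ \ R).biUnion g) := by
  induction k with
  | zero =>
    exact ⟨∅, by simp, ∅, by simp, R₀, subset_rfl, by simp, by simp, by simp, by simp, by simp,
      by simpa using .empty G m⟩
  | succ k ih =>
    rw [add_mul, one_mul] at hk hkM
    obtain ⟨S, hS, T, hT, R, hR, hSd, hTd, hSc, hTc, hRc, hti⟩ := ih (by lia) (by lia)
    have hnew : ∀ (Z W : Finset V) (f' : ι → Finset V), Z.card = n → W ⊆ Z → W.card = k * m →
        R₀.biUnion f' ⊆ Z → (R₀.biUnion f').card = R₀.card * t → Disjoint W (R₀.biUnion f') →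
        ∃ W' ⊆ Z, Disjoint W' (R₀.biUnion f') ∧ W'.card = m ∧ Disjoint W W' := by
      intro Z W f' hZ hW hWc hf hfc hd
      have hu : (Z \ (W ∪ R₀.biUnion f')).card + (k * m + R₀.card * t) = n := by
        rw [← hZ, ← hWc, ← hfc, ← card_union_of_disjoint hd]
        exact card_sdiff_add_card_eq_card (union_subset hW hf)
      obtain ⟨W', hW', hWc'⟩ := exists_subset_card_eq
        (show m ≤ (Z \ (W ∪ R₀.biUnion f')).card by lia)
      have := (disjoint_sdiff (s := W ∪ R₀.biUnion f') (t := Z)).mono_right hW'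
      rw [disjoint_union_left] at this
      exact ⟨W', hW'.trans sdiff_subset, this.2.symm, hWc', this.1⟩
    obtain ⟨S', hS', hSd', hSc', hSS⟩ := hnew X S f hX hS hSc h.biUnion_subset h.card_biUnion hSd
    obtain ⟨T', hT', hTd', hTc', hTT⟩ := hnew Y T g hY hT hTc h.swap.biUnion_subset
      h.swap.card_biUnion hTd
    obtain ⟨R', hR', hRc', hti'⟩ := exists_absorb h hm hmt hmt' hroute hroute' hS' hT' hSd' hTd'
      hSc' hTc' hR (by lia)
    have hRR : R₀ \ R' = (R₀ \ R) ∪ (R \ R') := by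
      ext x
      have a1 := fun hx : x ∈ R' => hR' hx
      have a2 := fun hx : x ∈ R => hR hx
      simp only [mem_union, mem_sdiff]
      grind
    have hsub₁ : R₀ \ R ⊆ R₀ := sdiff_subset
    have hsub₂ : R \ R' ⊆ R₀ := sdiff_subset.trans hR
    refine ⟨S ∪ S', union_subset hS hS', T ∪ T', union_subset hT hT', R', hR'.trans hR,
      disjoint_union_left.2 ⟨hSd, hSd'⟩, disjoint_union_left.2 ⟨hTd, hTd'⟩, ?_, ?_, by lia, ?_⟩
    · rw [card_union_of_disjoint hSS, hSc, hSc', add_mul, one_mul]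
    · rw [card_union_of_disjoint hTT, hTc, hTc', add_mul, one_mul]
    · rw [hRR, union_biUnion, union_biUnion, union_union_union_comm S, union_union_union_comm T]
      have hRd : ∀ i ∈ R₀ \ R, ∀ j ∈ R \ R', i ≠ j := by
        rintro i hi j hj rfl
        exact (mem_sdiff.1 hi).2 (mem_sdiff.1 hj).1
      refine hti.union hti' ?_ ?_
      · simp only [disjoint_union_left, disjoint_union_right]
        refine ⟨⟨hSS, ?_⟩, ?_, ?_⟩
        · exact (hSd'.mono_right (biUnion_subset_biUnion_of_subset_left f hsub₁)).symm
        · exact hSd.mono_right (biUnion_subset_biUnion_of_subset_left f hsub₂)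
        · simp only [disjoint_biUnion_left, disjoint_biUnion_right]
          exact fun j hj i hi => h.disj₁ i (hsub₁ hi) j (hsub₂ hj) (hRd i hi j hj)
      · simp only [disjoint_union_left, disjoint_union_right]
        refine ⟨⟨hTT, ?_⟩, ?_, ?_⟩
        · exact (hTd'.mono_right (biUnion_subset_biUnion_of_subset_left g hsub₁)).symm
        · exact hTd.mono_right (biUnion_subset_biUnion_of_subset_left g hsub₂)
        · simp only [disjoint_biUnion_left, disjoint_biUnion_right]
          exact fun j hj i hi => h.disj₂ i (hsub₁ hi) j (hsub₂ hj) (hRd i hi j hj)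

lemma exists_absorb_all {ι : Type*} {G : SimpleGraph V} {X Y : Finset V} {n m t M : ℕ}
    {R₀ : Finset ι} {f g : ι → Finset V} (h : IsFamily G X Y t R₀ f g) (hm : 0 < m)
    (hmt : m ∣ t) (hmt' : 2 * m ^ 2 ≤ t) (hX : X.card = n) (hY : Y.card = n)
    (hroute : ∀ Q ⊆ Y, Q.card = t → ∀ R ⊆ R₀, M ≤ R.card → ∀ v ∈ X, v ∉ R₀.biUnion f →
      ∃ i ∈ R, ∃ j ∈ R, i ≠ j ∧ ∃ p ∈ f j, 2 * m ^ 2 ≤ degIn G p Q ∧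
        Tileable G m (insert v ((f i ∪ f j).erase p)) (g i ∪ g j))
    (hroute' : ∀ Q ⊆ X, Q.card = t → ∀ R ⊆ R₀, M ≤ R.card → ∀ v ∈ Y, v ∉ R₀.biUnion g →
      ∃ i ∈ R, ∃ j ∈ R, i ≠ j ∧ ∃ p ∈ g j, 2 * m ^ 2 ≤ degIn G p Q ∧
        Tileable G m (insert v ((g i ∪ g j).erase p)) (f i ∪ f j))
    (htile : ∀ R ⊆ R₀, Tileable G m (R.biUnion f) (R.biUnion g)) (k : ℕ)
    (hk : k * m + R₀.card * t ≤ n) (hkM : M + k * (4 * m + 1) ≤ R₀.card) :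
    ∃ A ⊆ X, ∃ B ⊆ Y, Tileable G m A B ∧ A.card = k * m + R₀.card * t := by
  obtain ⟨S, hS, T, hT, R, hR, hSd, hTd, hSc, hTc, -, hti⟩ := exists_absorb_iterate h hm hmt hmt'
    hX hY hroute hroute' k hk hkM
  have e₁ : S ∪ (R₀ \ R).biUnion f ∪ R.biUnion f = S ∪ R₀.biUnion f := by
    rw [union_assoc, ← union_biUnion, sdiff_union_of_subset hR]
  have e₂ : T ∪ (R₀ \ R).biUnion g ∪ R.biUnion g = T ∪ R₀.biUnion g := by
    rw [union_assoc, ← union_biUnion, sdiff_union_of_subset hR]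
  have hd : ∀ i ∈ R₀ \ R, ∀ j ∈ R, i ≠ j := by
    rintro i hi j hj rfl
    exact (mem_sdiff.1 hi).2 hj
  have hall := hti.union (htile R hR) ?_ ?_
  · rw [e₁, e₂] at hall
    refine ⟨_, union_subset hS h.biUnion_subset, _, union_subset hT h.swap.biUnion_subset, hall, ?_⟩
    rw [card_union_of_disjoint hSd, hSc, h.card_biUnion]
  · refine disjoint_union_left.2 ⟨hSd.mono_right (biUnion_subset_biUnion_of_subset_left f hR), ?_⟩
    simp only [disjoint_biUnion_left, disjoint_biUnion_right]
    exact fun j hj i hi => h.disj₁ i (sdiff_subset hi) j (hR hj) (hd i hi j hj)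
  · refine disjoint_union_left.2 ⟨hTd.mono_right (biUnion_subset_biUnion_of_subset_left g hR), ?_⟩
    simp only [disjoint_biUnion_left, disjoint_biUnion_right]
    exact fun j hj i hi => h.disj₂ i (sdiff_subset hi) j (hR hj) (hd i hi j hj)

/-- If there is no large sparse pair, all but fewer than `m` vertices on each side can be tiled. -/
theorem exists_tileable_of_noSparsePair {m : ℕ} (hm : 0 < m) {c : ℝ} (hc : 0 < c) (hc1 : c ≤ 1) :
    ∃ n₀ : ℕ, ∀ (V : Type) (G : SimpleGraph V) (X Y : Finset V) (n : ℕ), n₀ ≤ n →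
      X.card = n → Y.card = n →
      (∀ x ∈ X, (n : ℝ) / 2 ≤ degIn G x Y) → (∀ y ∈ Y, (n : ℝ) / 2 ≤ degIn G y X) →
      NoSparsePair G X Y n c → ∃ A ⊆ X, ∃ B ⊆ Y, Tileable G m A B ∧ n < A.card + m := by
  obtain ⟨r, hr⟩ := exists_nat_ge (8 * m / c)
  rw [div_le_iff₀ hc] at hr
  have hm' : (1 : ℝ) ≤ m := by exact_mod_cast hm
  set t : ℕ := m * (r + 2 * m) with ht
  have hmt : m ∣ t := dvd_mul_right _ _
  have hmt' : 2 * m ^ 2 ≤ t := by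
    rw [ht]; nlinarith [Nat.zero_le (m * r)]
  have ht0 : 0 < t := lt_of_lt_of_le (by positivity) hmt'
  have hKt : ((2 * m ^ 2 : ℕ) : ℝ) ≤ c / 4 * t := by
    rw [ht]
    push_cast
    have h1 : (m : ℝ) * (8 * m) ≤ m * (r * c) := by gcongr
    have h2 : 0 ≤ (m : ℝ) * (2 * m) * c := by positivity
    nlinarith
  set γ : ℝ := c / (8 * (1 + 5 * t)) with hγ
  have hγ0 : 0 < γ := by positivity
  have hγt : γ * (1 + 5 * t) = c / 8 := by rw [hγ]; field_simp
  obtain ⟨n₀, hn₀⟩ := exists_almost_tiling t ht0 hγ0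
  refine ⟨max n₀ (⌈8 * t / c⌉₊ + 1), fun V G X Y n hn hX hY hdX hdY hG => ?_⟩
  obtain ⟨R₀, hR₀, hcov⟩ := hn₀ V G X Y n (le_trans (le_max_left _ _) hn) hX hY hdX hdY
  have hn1 : 8 * t / c < n := by
    refine lt_of_le_of_lt (Nat.le_ceil _) ?_
    exact_mod_cast lt_of_lt_of_le (Nat.lt_succ_self _) (le_trans (le_max_right _ _) hn)
  rw [div_lt_iff₀ hc] at hn1
  have ht0' : (0 : ℝ) < t := by exact_mod_cast ht0
  have h := hR₀.isFamily
  set M := ⌈(1 - c / 4) * n / t⌉₊ with hM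
  have hMr : ∀ R : Finset (Finset V × Finset V), M ≤ R.card →
      (1 - c / 4) * n ≤ (R.card : ℝ) * t := by
    intro R hR
    rw [← div_le_iff₀ ht0']
    exact (Nat.le_ceil _).trans (by exact_mod_cast hR)
  have h2m : 2 * m ≤ 2 * m ^ 2 := by nlinarith
  have hmm : m ≤ 2 * m ^ 2 := by lia
  have hcR : R₀.card * t ≤ n := by
    rw [← h.card_biUnion, ← hX]; exact card_le_card h.biUnion_subset
  set k := (n - R₀.card * t) / m with hk
  have hkm : k * m ≤ n - R₀.card * t := Nat.div_mul_le_self _ _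
  have hkm' : n - R₀.card * t < k * m + m := by
    rw [hk]; exact Nat.lt_div_mul_add hm
  have hkr : (k : ℝ) * m ≤ γ * n := by
    have : ((k * m : ℕ) : ℝ) ≤ ((n - R₀.card * t : ℕ) : ℝ) := by exact_mod_cast hkm
    push_cast [Nat.cast_sub hcR] at this
    linarith
  have hMk : M + k * (4 * m + 1) ≤ R₀.card := by
    have e1 : (0 : ℝ) ≤ γ * n * t := by positivity
    have e2 : (k : ℝ) * (4 * m + 1) ≤ 5 * (γ * n) := by nlinarith [Nat.cast_nonneg (α := ℝ) k]
    have e3 : (1 - c / 4) * n / t + (k * (4 * m + 1) + 1) ≤ R₀.card := by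
      rw [← mul_le_mul_iff_left₀ ht0', add_mul, div_mul_cancel₀ _ ht0'.ne']
      have e4 : (k : ℝ) * (4 * m + 1) * t ≤ 5 * (γ * n) * t := by gcongr
      have e5 : γ * (1 + 5 * t) * n = c / 8 * n := by rw [hγt]
      nlinarith
    have e6 := Nat.ceil_lt_add_one (show 0 ≤ (1 - c / 4) * n / t by
      have : 0 ≤ 1 - c / 4 := by linarith
      positivity)
    rw [← hM] at e6
    have : ((M + k * (4 * m + 1) : ℕ) : ℝ) ≤ R₀.card := by push_cast; linarith
    exact_mod_cast this
  have htn : (t : ℝ) < c / 2 * n := by nlinarith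
  obtain ⟨A, hA, B, hB, hAB, hAc⟩ := exists_absorb_all h hm hmt hmt'
    hX hY
    (fun Q hQ hQt R hR hRM v hv hvR => exists_route (h.subset hR) hm hmt (h2m.trans hmt') hmm hc
      hKt htn hX hY hdX hdY hG (hMr R hRM) hQ hQt hv
      fun hv' => hvR (biUnion_subset_biUnion_of_subset_left _ hR hv'))
    (fun Q hQ hQt R hR hRM v hv hvR => exists_route (h.subset hR).swap hm hmt (h2m.trans hmt') hmm
      hc hKt htn hY hX hdY hdX hG.swap (hMr R hRM) hQ hQt hv
      fun hv' => hvR (biUnion_subset_biUnion_of_subset_left _ hR hv'))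
    (fun R hR => by
      obtain ⟨q, hq⟩ := hmt
      have := (hR₀.subset hR).tileable
      rw [hq, mul_comm] at this
      exact this.refine) k (by lia) hMk
  exact ⟨A, hA, B, hB, hAB, by lia⟩

lemma card_le_card_commonNbr_add {G : SimpleGraph V} {A L : Finset V} {μ : ℝ}
    (h : ∀ y ∈ L, (A.card : ℝ) ≤ degIn G y A + μ) :
    (A.card : ℝ) ≤ (A.filter fun x => ∀ y ∈ L, G.Adj x y).card + L.card * μ := by
  have h1 : A ⊆ (A.filter fun x => ∀ y ∈ L, G.Adj x y) ∪
      L.biUnion fun y => A.filter fun x => ¬ G.Adj y x := by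
    intro x hx
    by_cases hxL : ∀ y ∈ L, G.Adj x y
    · exact mem_union_left _ (mem_filter.2 ⟨hx, hxL⟩)
    · push Not at hxL
      obtain ⟨y, hy, hxy⟩ := hxL
      exact mem_union_right _ (mem_biUnion.2 ⟨y, hy, mem_filter.2 ⟨hx, fun h => hxy h.symm⟩⟩)
  have h2 := (card_le_card h1).trans ((card_union_le _ _).trans
    (Nat.add_le_add_left card_biUnion_le _))
  have h3 : ∑ y ∈ L, ((A.filter fun x => ¬ G.Adj y x).card : ℝ) ≤ L.card * μ := by
    rw [← nsmul_eq_mul]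
    refine sum_le_card_nsmul _ _ _ fun y hy => ?_
    have a := card_filter_add_card_filter_not (s := A) (fun x => G.Adj y x)
    have b := h y hy
    rw [← a, degIn] at b
    push_cast at b
    linarith
  have h4 : (A.card : ℝ) ≤ (A.filter fun x => ∀ y ∈ L, G.Adj x y).card +
      ∑ y ∈ L, ((A.filter fun x => ¬ G.Adj y x).card : ℝ) := by exact_mod_cast h2
  linarith

/-- Greedily covering `k` vertices of `S` by disjoint copies of `K_{m,m}` whose other vertices lie
in `A` and `B`. -/
lemma exists_greedy_cover {G : SimpleGraph V} {m k : ℕ} (hm : 0 < m) {S A B : Finset V} {μ : ℝ}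
    (hSA : Disjoint S A)
    (hS : ∀ S' ⊆ S, ∀ L ⊆ B, S'.card < k → L.card = S'.card * m →
      ∃ x ∈ S \ S', m ≤ degIn G x (B \ L))
    (hB : ∀ y ∈ B, (A.card : ℝ) ≤ degIn G y A + μ) (hA : m * μ + k * m ≤ A.card) (j : ℕ)
    (hj : j ≤ k) :
    ∃ S' ⊆ S, ∃ Z ⊆ A, ∃ L ⊆ B, S'.card = j ∧ Z.card = j * (m - 1) ∧ L.card = j * m ∧
      Tileable G m (S' ∪ Z) L := by
  induction j with
  | zero =>
    exact ⟨∅, by simp, ∅, by simp, ∅, by simp, by simp, by simp, by simp,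
      by simpa using .empty G m⟩
  | succ j ih =>
    obtain ⟨S', hS', Z, hZ, L, hL, hSc, hZc, hLc, hT⟩ := ih (by lia)
    obtain ⟨x, hx, hxL⟩ := hS S' hS' L hL (by lia) (by rw [hLc, hSc])
    obtain ⟨hxS, hxS'⟩ := mem_sdiff.1 hx
    obtain ⟨L', hL', hLc'⟩ := exists_subset_card_eq hxL
    have hL'B : L' ⊆ B \ L := hL'.trans (filter_subset _ _)
    have h1 := card_le_card_commonNbr_add (G := G) (A := A) (L := L') (μ := μ)
      fun y hy => hB y (sdiff_subset (hL'B hy))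
    rw [hLc'] at h1
    set W := A.filter fun x => ∀ y ∈ L', G.Adj x y with hW
    have h2 : k * m ≤ W.card := by
      have : (k * m : ℝ) ≤ W.card := by linarith
      exact_mod_cast this
    have h3 : m - 1 ≤ (W \ Z).card := by
      have a := le_card_sdiff Z W
      have b : j * (m - 1) + (m - 1) ≤ k * m := by
        calc j * (m - 1) + (m - 1) = (j + 1) * (m - 1) := by ring
          _ ≤ k * m := Nat.mul_le_mul hj (Nat.sub_le _ _)
      lia
    obtain ⟨Z', hZ', hZc'⟩ := exists_subset_card_eq h3
    have hZ'A : Z' ⊆ A := hZ'.trans (sdiff_subset.trans (filter_subset _ _))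
    have hxA : x ∉ A := disjoint_left.1 hSA hxS
    have hT' : Tileable G m (insert x Z') L' := by
      refine Joined.tileable ?_ ?_ hLc'
      · intro z hz y hy
        rcases mem_insert.1 hz with rfl | hz
        · exact (mem_filter.1 (hL' hy)).2
        · exact (mem_filter.1 (mem_sdiff.1 (hZ' hz)).1).2 y hy
      · rw [card_insert_of_notMem fun hx => hxA (hZ'A hx), hZc']; lia
    have hZZ : Disjoint Z Z' := disjoint_sdiff.mono_right hZ'
    have hLL : Disjoint L L' := disjoint_sdiff.mono_right hL'B
    refine ⟨insert x S', insert_subset hxS hS', Z ∪ Z', union_subset hZ hZ'A, L ∪ L',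
      union_subset hL (hL'B.trans sdiff_subset), ?_, ?_, ?_, ?_⟩
    · rw [card_insert_of_notMem hxS', hSc]
    · rw [card_union_of_disjoint hZZ, hZc, hZc']; ring
    · rw [card_union_of_disjoint hLL, hLc, hLc']; ring
    · have := hT.union hT' ?_ hLL
      · convert this using 1
        ext z
        simp only [mem_union, mem_insert]
        tauto
      · rw [disjoint_insert_right, disjoint_union_left]
        refine ⟨?_, hSA.mono hS' hZ'A, hZZ⟩
        rw [mem_union, not_or]
        exact ⟨hxS', fun hx => hxA (hZ hx)⟩

lemma card_filter_degIn_lt_le {G : SimpleGraph V} {P Q : Finset V} {N : ℕ} {η ρ : ℝ}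
    (hη : 0 < η) (hN : 0 < N) (hP : P.card = N) (hQ : Q.card = N)
    (h : (1 - η * ρ) * N ^ 2 ≤ ∑ p ∈ P, (degIn G p Q : ℝ)) :
    ((P.filter fun p => (degIn G p Q : ℝ) < (1 - η) * N).card : ℝ) ≤ ρ * N := by
  set E := P.filter fun p => (degIn G p Q : ℝ) < (1 - η) * N with hE
  have h1 : ∑ p ∈ P, (degIn G p Q : ℝ) ≤ ∑ p ∈ P, ((N : ℝ) - if (degIn G p Q : ℝ) < (1 - η) * N
      then η * N else 0) := by
    refine sum_le_sum fun p _ => ?_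
    split_ifs with hp
    · linarith
    · have := degIn_le_card G p Q
      rw [hQ] at this
      simpa using this
  rw [sum_sub_distrib, sum_const, ← sum_filter, sum_const, ← hE, hP, nsmul_eq_mul,
    nsmul_eq_mul] at h1
  have hN' : (0 : ℝ) < η * N := by positivity
  refine le_of_mul_le_mul_right ?_ hN'
  nlinarith

lemma exists_tileable_of_degIn_ge {m : ℕ} (hm : 0 < m) :
    ∃ n₀ : ℕ, ∀ (V : Type) (G : SimpleGraph V) (P Q : Finset V) (N : ℕ), n₀ ≤ N →
      P.card = N → Q.card = N → (∀ x ∈ P, 9 / 10 * (N : ℝ) ≤ degIn G x Q) →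
      (∀ y ∈ Q, 9 / 10 * (N : ℝ) ≤ degIn G y P) →
      ∃ A ⊆ P, ∃ B ⊆ Q, Tileable G m A B ∧ N < A.card + m := by
  obtain ⟨n₀, hn₀⟩ := exists_tileable_of_noSparsePair hm (c := 1 / 10) (by norm_num) (by norm_num)
  refine ⟨n₀, fun V G P Q N hN hP hQ hdP hdQ => ?_⟩
  have hN0 : (0 : ℝ) ≤ N := Nat.cast_nonneg _
  refine hn₀ V G P Q N hN hP hQ (fun x hx => by have := hdP x hx; linarith)
    (fun y hy => by have := hdQ y hy; linarith) fun A hA B hB hAc hBc => ?_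
  calc (1 / 10 : ℝ) * N ^ 2 ≤ A.card * (3 / 10 * N) := by nlinarith
    _ ≤ ∑ a ∈ A, (degIn G a B : ℝ) := by
      rw [← nsmul_eq_mul]
      refine card_nsmul_le_sum _ _ _ fun a ha => ?_
      have h1 := hdP a (hA ha)
      have h2 : (degIn G a Q : ℝ) ≤ degIn G a B + (Q \ B).card := by
        exact_mod_cast degIn_le_add_sdiff G a Q B
      have h3 : ((Q \ B).card : ℝ) + B.card = Q.card := by
        exact_mod_cast card_sdiff_add_card_eq_card hB
      rw [hQ] at h3
      linarith

set_option maxHeartbeats 400000 in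
/-- Nearly complete balanced pairs with a linear minimum degree can be tiled up to fewer than `m`
vertices on each side. -/
lemma exists_tileable_of_nearly_complete {m : ℕ} (hm : 0 < m) {θ : ℝ} (hθ : 0 < θ)
    (hθ1 : θ ≤ 1 / 10) :
    ∃ ε : ℝ, 0 < ε ∧ ∃ N₀ : ℕ, ∀ (V : Type) (G : SimpleGraph V) (P Q : Finset V) (N : ℕ),
      N₀ ≤ N → P.card = N → Q.card = N →
      (∀ x ∈ P, θ * N ≤ degIn G x Q) → (∀ y ∈ Q, θ * N ≤ degIn G y P) →
      (1 - ε) * N ^ 2 ≤ ∑ p ∈ P, (degIn G p Q : ℝ) →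
      ∃ A ⊆ P, ∃ B ⊆ Q, Tileable G m A B ∧ N < A.card + m := by
  obtain ⟨n₀, hn₀⟩ := exists_tileable_of_degIn_ge hm
  have hm' : (1 : ℝ) ≤ m := by exact_mod_cast hm
  set η : ℝ := 1 / (20 * m) with hη
  set ρ : ℝ := θ / (8 * m) with hρ
  have hη0 : 0 < η := by positivity
  have hρ0 : 0 < ρ := by positivity
  have hmη : m * η = 1 / 20 := by rw [hη]; field_simp
  have hmρ : m * ρ = θ / 8 := by rw [hρ]; field_simp
  have hη1 : η ≤ 1 / 20 := by nlinarith
  have hρ1 : ρ ≤ θ / 8 := by nlinarith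
  refine ⟨η * ρ, by positivity, max (2 * n₀) (⌈4 * m / θ⌉₊ + 1),
    fun V G P Q N hN hP hQ hdP hdQ hPQ => ?_⟩
  have hN0 : 0 < N := by
    have := le_trans (le_max_right _ _) hN
    lia
  have hN0' : (0 : ℝ) < N := by exact_mod_cast hN0
  have hN1 : 4 * m ≤ θ * N := by
    have h1 : 4 * m / θ ≤ N := (Nat.le_ceil _).trans
      (by exact_mod_cast (Nat.le_succ _).trans (le_trans (le_max_right _ _) hN))
    rw [div_le_iff₀ hθ] at h1
    linarith
  have hQP : (1 - η * ρ) * N ^ 2 ≤ ∑ q ∈ Q, (degIn G q P : ℝ) := by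
    have h2 : ∑ a ∈ P, (degIn G a Q : ℝ) = ∑ b ∈ Q, (degIn G b P : ℝ) := by
      exact_mod_cast sum_degIn_comm G P Q
    rwa [← h2]
  have hEP := card_filter_degIn_lt_le hη0 hN0 hP hQ hPQ
  have hEQ := card_filter_degIn_lt_le hη0 hN0 hQ hP hQP
  have hP' : ∀ p ∈ P \ P.filter (fun p => (degIn G p Q : ℝ) < (1 - η) * N),
      (1 - η) * N ≤ degIn G p Q := by
    intro p hp
    simp only [mem_sdiff, mem_filter, not_and, not_lt] at hp
    exact hp.2 hp.1
  have hQ' : ∀ p ∈ Q \ Q.filter (fun p => (degIn G p P : ℝ) < (1 - η) * N),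
      (1 - η) * N ≤ degIn G p P := by
    intro p hp
    simp only [mem_sdiff, mem_filter, not_and, not_lt] at hp
    exact hp.2 hp.1
  have hEPs : P.filter (fun p => (degIn G p Q : ℝ) < (1 - η) * N) ⊆ P := filter_subset _ _
  have hEQs : Q.filter (fun p => (degIn G p P : ℝ) < (1 - η) * N) ⊆ Q := filter_subset _ _
  generalize P.filter (fun p => (degIn G p Q : ℝ) < (1 - η) * N) = E at *
  generalize Q.filter (fun p => (degIn G p P : ℝ) < (1 - η) * N) = F at *
  have hmE : (E.card : ℝ) * m ≤ θ / 8 * N := by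
    rw [← hmρ]; nlinarith
  have hmF : (F.card : ℝ) * m ≤ θ / 8 * N := by
    rw [← hmρ]; nlinarith
  have hE8 : (E.card : ℝ) ≤ θ / 8 * N := hEP.trans (by gcongr)
  have hF8 : (F.card : ℝ) ≤ θ / 8 * N := hEQ.trans (by gcongr)
  have hθN : θ * N ≤ 1 / 10 * N := by gcongr
  have hdeg : ∀ (x : V) (B C : Finset V), (degIn G x B : ℝ) ≤ degIn G x C + (B \ C).card :=
    fun x B C => by exact_mod_cast degIn_le_add_sdiff G x B C
  have hsd : ∀ A B : Finset V, A ⊆ B → ((B \ A).card : ℝ) + A.card = B.card :=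
    fun A B h => by exact_mod_cast card_sdiff_add_card_eq_card h
  have hPE := hsd E P hEPs
  have hQF := hsd F Q hEQs
  rw [hP] at hPE
  rw [hQ] at hQF
  obtain ⟨E', hE', Z, hZ, L, hL, hEc, hZc, hLc, hT1⟩ := exists_greedy_cover (G := G) (k := E.card)
    hm (S := E) (A := P \ E) (B := Q \ F) (μ := η * N) disjoint_sdiff
    (by
      intro S' hS' L hL hlt hLc
      obtain ⟨x, hx⟩ : (E \ S').Nonempty := by
        rw [← card_pos]
        have := card_sdiff_add_card_eq_card hS'
        lia
      refine ⟨x, hx, ?_⟩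
      have h1 := hdP x (hEPs (sdiff_subset hx))
      have h2 := hdeg x Q (Q \ F)
      have h3 := hdeg x (Q \ F) ((Q \ F) \ L)
      rw [Finset.sdiff_sdiff_eq_self hEQs] at h2
      rw [Finset.sdiff_sdiff_eq_self hL, hLc] at h3
      have h4 : ((S'.card * m : ℕ) : ℝ) ≤ E.card * m := by
        push_cast
        gcongr
      have : (m : ℝ) ≤ degIn G x ((Q \ F) \ L) := by linarith
      exact_mod_cast this)
    (by
      intro y hy
      have h1 := hQ' y hy
      have h2 := hdeg y P (P \ E)
      rw [Finset.sdiff_sdiff_eq_self hEPs] at h2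
      linarith)
    (by nlinarith) E.card le_rfl
  obtain rfl := eq_of_subset_of_card_le hE' hEc.ge
  have hLr : (L.card : ℝ) = E'.card * m := by rw [hLc]; push_cast; rfl
  have hZr : (Z.card : ℝ) ≤ E'.card * m := by
    rw [hZc]
    push_cast
    gcongr
    exact_mod_cast Nat.sub_le _ _
  have hZP := hsd Z _ hZ
  have hLQ := hsd L _ hL
  obtain ⟨F', hF', Z', hZ', L', hL', hFc, hZc', hLc', hT2⟩ := exists_greedy_cover (G := G)
    (k := F.card) hm (S := F) (A := (Q \ F) \ L) (B := (P \ E') \ Z) (μ := η * N)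
    (disjoint_sdiff.mono_right sdiff_subset)
    (by
      intro S' hS' L' hL' hlt hLc'
      obtain ⟨x, hx⟩ : (F \ S').Nonempty := by
        rw [← card_pos]
        have := card_sdiff_add_card_eq_card hS'
        lia
      refine ⟨x, hx, ?_⟩
      have h1 := hdQ x (hEQs (sdiff_subset hx))
      have h2 := hdeg x P (P \ E')
      have h3 := hdeg x (P \ E') ((P \ E') \ Z)
      have h4 := hdeg x ((P \ E') \ Z) (((P \ E') \ Z) \ L')
      rw [Finset.sdiff_sdiff_eq_self hEPs] at h2
      rw [Finset.sdiff_sdiff_eq_self hZ] at h3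
      rw [Finset.sdiff_sdiff_eq_self hL', hLc'] at h4
      have h5 : ((S'.card * m : ℕ) : ℝ) ≤ F.card * m := by
        push_cast
        gcongr
      have : (m : ℝ) ≤ degIn G x (((P \ E') \ Z) \ L') := by linarith
      exact_mod_cast this)
    (by
      intro y hy
      have h1 := hP' y (sdiff_subset hy)
      have h2 := hdeg y Q (Q \ F)
      have h3 := hdeg y (Q \ F) ((Q \ F) \ L)
      rw [Finset.sdiff_sdiff_eq_self hEQs] at h2
      rw [Finset.sdiff_sdiff_eq_self hL] at h3
      linarith)
    (by nlinarith) F.card le_rfl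
  obtain rfl := eq_of_subset_of_card_le hF' hFc.ge
  have hL'r : (L'.card : ℝ) = F'.card * m := by rw [hLc']; push_cast; rfl
  have hZ'r : (Z'.card : ℝ) ≤ F'.card * m := by
    rw [hZc']
    push_cast
    gcongr
    exact_mod_cast Nat.sub_le _ _
  have hT3 := hT1.union hT2.swap
    (by
      rw [disjoint_union_left]
      exact ⟨disjoint_sdiff.mono_right (hL'.trans sdiff_subset), disjoint_sdiff.mono_right hL'⟩)
    (by
      rw [disjoint_union_right]
      exact ⟨(disjoint_sdiff.mono_right hL).symm, disjoint_sdiff.mono_right hZ'⟩)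
  have hP₁ : E' ∪ Z ∪ L' ⊆ P := union_subset (union_subset hEPs (hZ.trans sdiff_subset))
    (hL'.trans (sdiff_subset.trans sdiff_subset))
  have hQ₁ : L ∪ (F' ∪ Z') ⊆ Q := union_subset (hL.trans sdiff_subset)
    (union_subset hEQs (hZ'.trans (sdiff_subset.trans sdiff_subset)))
  have hc₁ : ((E' ∪ Z ∪ L').card : ℝ) ≤ 3 * (θ / 8 * N) := by
    have a : ((E' ∪ Z ∪ L').card : ℝ) ≤ E'.card + Z.card + L'.card := by
      exact_mod_cast (card_union_le _ _).trans (Nat.add_le_add_right (card_union_le _ _) _)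
    linarith
  have hc₂ : (L ∪ (F' ∪ Z')).card = (E' ∪ Z ∪ L').card := hT3.card_eq.symm
  have hEP₁ : E' ⊆ E' ∪ Z ∪ L' := subset_union_left.trans subset_union_left
  have hFQ₁ : F' ⊆ L ∪ (F' ∪ Z') := subset_union_left.trans subset_union_right
  generalize E' ∪ Z ∪ L' = P₁ at *
  generalize L ∪ (F' ∪ Z') = Q₁ at *
  have hPP₁ := card_sdiff_add_card_eq_card hP₁
  have hQQ₁ := card_sdiff_add_card_eq_card hQ₁
  rw [hP] at hPP₁
  rw [hQ, hc₂] at hQQ₁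
  have hPP₁r : ((P \ P₁).card : ℝ) + P₁.card = N := by exact_mod_cast hPP₁
  have hc₂r : (Q₁.card : ℝ) = P₁.card := by exact_mod_cast hc₂
  have hlow : ∀ x : V, ∀ B C : Finset V, C ⊆ B → C.card = P₁.card → (1 - η) * N ≤ degIn G x B →
      9 / 10 * (P \ P₁).card ≤ (degIn G x (B \ C) : ℝ) := by
    intro x B C hC hCc hx
    have := hdeg x B (B \ C)
    rw [Finset.sdiff_sdiff_eq_self hC, hCc] at this
    nlinarith
  have hdX : ∀ x ∈ P \ P₁, 9 / 10 * (P \ P₁).card ≤ (degIn G x (Q \ Q₁) : ℝ) := fun x hx =>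
    hlow x Q Q₁ hQ₁ hc₂ (hP' x (sdiff_subset_sdiff subset_rfl hEP₁ hx))
  have hdY : ∀ y ∈ Q \ Q₁, 9 / 10 * (P \ P₁).card ≤ (degIn G y (P \ P₁) : ℝ) := fun y hy =>
    hlow y P P₁ hP₁ rfl (hQ' y (sdiff_subset_sdiff subset_rfl hFQ₁ hy))
  have hMn : n₀ ≤ (P \ P₁).card := by
    have h1 : (N : ℝ) / 2 ≤ (P \ P₁).card := by linarith
    have h2 : 2 * (n₀ : ℝ) ≤ N := by exact_mod_cast le_trans (le_max_left _ _) hN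
    have : (n₀ : ℝ) ≤ (P \ P₁).card := by linarith
    exact_mod_cast this
  obtain ⟨A, hA, B, hB, hAB, hAc⟩ := hn₀ V G (P \ P₁) (Q \ Q₁) (P \ P₁).card hMn rfl (by lia)
    hdX hdY
  refine ⟨P₁ ∪ A, union_subset hP₁ (hA.trans sdiff_subset), Q₁ ∪ B,
    union_subset hQ₁ (hB.trans sdiff_subset), hT3.union hAB (disjoint_sdiff.mono_right hA)
    (disjoint_sdiff.mono_right hB), ?_⟩
  rw [card_union_of_disjoint (disjoint_sdiff.mono_right hA)]
  lia

lemma card_mul_card_le_sum_degIn_of_subset {G : SimpleGraph V} {P Q P' Q' : Finset V} {b : ℝ}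
    (hP : P' ⊆ P) (hQ : Q' ⊆ Q)
    (h : (P.card : ℝ) * Q.card ≤ ∑ x ∈ P, (degIn G x Q : ℝ) + b) :
    (P'.card : ℝ) * Q'.card ≤ ∑ x ∈ P', (degIn G x Q' : ℝ) + b := by
  have h1 : ∑ x ∈ P', ((Q'.card : ℝ) - degIn G x Q') ≤ ∑ x ∈ P', ((Q.card : ℝ) - degIn G x Q) := by
    refine sum_le_sum fun x _ => ?_
    have a : (degIn G x Q : ℝ) ≤ degIn G x Q' + (Q \ Q').card := by
      exact_mod_cast degIn_le_add_sdiff G x Q Q'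
    have b : ((Q \ Q').card : ℝ) + Q'.card = Q.card := by
      exact_mod_cast card_sdiff_add_card_eq_card hQ
    linarith
  have h2 : ∑ x ∈ P', ((Q.card : ℝ) - degIn G x Q) ≤ ∑ x ∈ P, ((Q.card : ℝ) - degIn G x Q) := by
    refine sum_le_sum_of_subset_of_nonneg hP fun x _ _ => ?_
    rw [sub_nonneg]
    exact_mod_cast degIn_le_card G x Q
  have h3 := h1.trans h2
  simp only [sum_sub_distrib, sum_const, nsmul_eq_mul] at h3
  linarith

lemma exists_tileable_of_nearly_complete_subset {m : ℕ} (hm : 0 < m) {θ : ℝ} (hθ : 0 < θ)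
    (hθ1 : θ ≤ 1 / 10) :
    ∃ ε : ℝ, 0 < ε ∧ ∃ n₀ : ℕ, ∀ (V : Type) (G : SimpleGraph V) (P Q P' Q' : Finset V) (n : ℕ),
      n₀ ≤ n → P' ⊆ P → Q' ⊆ Q → P'.card = Q'.card → (n : ℝ) / 4 ≤ P'.card → P'.card ≤ n →
      ((P \ P').card : ℝ) ≤ θ / 2 * n → ((Q \ Q').card : ℝ) ≤ θ / 2 * n →
      (∀ x ∈ P, θ * n ≤ degIn G x Q) → (∀ y ∈ Q, θ * n ≤ degIn G y P) →
      (P.card : ℝ) * Q.card ≤ ∑ x ∈ P, (degIn G x Q : ℝ) + ε * n ^ 2 →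
      ∃ A ⊆ P', ∃ B ⊆ Q', Tileable G m A B ∧ P'.card < A.card + m := by
  obtain ⟨ε, hε, N₀, hN₀⟩ := exists_tileable_of_nearly_complete hm (half_pos hθ) (by linarith)
  refine ⟨ε / 16, by positivity, 4 * N₀, fun V G P Q P' Q' n hn hP hQ hPQ hlow hle hPd hQd hdP hdQ
    hsum => ?_⟩
  have hle' : (P'.card : ℝ) ≤ n := by exact_mod_cast hle
  refine hN₀ V G P' Q' P'.card ?_ rfl hPQ.symm ?_ ?_ ?_
  · have h1 : (4 : ℝ) * N₀ ≤ n := by exact_mod_cast hn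
    have : (N₀ : ℝ) ≤ P'.card := by linarith
    exact_mod_cast this
  · intro x hx
    have a : (degIn G x Q : ℝ) ≤ degIn G x Q' + (Q \ Q').card := by
      exact_mod_cast degIn_le_add_sdiff G x Q Q'
    have b := hdP x (hP hx)
    nlinarith
  · intro x hx
    have a : (degIn G x P : ℝ) ≤ degIn G x P' + (P \ P').card := by
      exact_mod_cast degIn_le_add_sdiff G x P P'
    have b := hdQ x (hQ hx)
    nlinarith
  · have h1 := card_mul_card_le_sum_degIn_of_subset hP hQ hsum
    rw [← hPQ] at h1
    have h2 : ((n : ℝ) / 4) ^ 2 ≤ (P'.card : ℝ) ^ 2 := by gcongr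
    nlinarith

/-- A splitting of a bipartite graph into two nearly complete pairs `(X₁, Y₁)` and `(X₂, Y₂)`, with
`X₁` larger than `Y₁` by `d`, and few edges between `X₁` and `Y₂` unless `d = 0`. -/
structure IsSplit (G : SimpleGraph V) (X₁ X₂ Y₁ Y₂ : Finset V) (n d : ℕ) (θ ε : ℝ) : Prop where
  disjX : Disjoint X₁ X₂
  disjY : Disjoint Y₁ Y₂
  cardX : X₁.card + X₂.card = n
  cardY : Y₁.card + Y₂.card = n
  diff : X₁.card = Y₁.card + d
  d_le : (d : ℝ) ≤ ε * n
  lowX₁ : (1 / 2 - ε) * n ≤ X₁.card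
  lowX₂ : (1 / 2 - ε) * n ≤ X₂.card
  lowY₁ : (1 / 2 - ε) * n ≤ Y₁.card
  lowY₂ : (1 / 2 - ε) * n ≤ Y₂.card
  degX₁ : ∀ x ∈ X₁, θ * n ≤ degIn G x Y₁
  degX₂ : ∀ x ∈ X₂, θ * n ≤ degIn G x Y₂
  degY₁ : ∀ y ∈ Y₁, θ * n ≤ degIn G y X₁
  degY₂ : ∀ y ∈ Y₂, θ * n ≤ degIn G y X₂
  totalX : ∀ x ∈ X₁, (n : ℝ) / 2 ≤ degIn G x Y₁ + degIn G x Y₂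
  totalY : ∀ y ∈ Y₂, (n : ℝ) / 2 ≤ degIn G y X₁ + degIn G y X₂
  crossX : 0 < d → ∀ x ∈ X₁, (degIn G x Y₂ : ℝ) ≤ 4 * θ * n
  crossY : 0 < d → ∀ y ∈ Y₂, (degIn G y X₁ : ℝ) ≤ 4 * θ * n
  sum₁ : (X₁.card : ℝ) * Y₁.card ≤ ∑ x ∈ X₁, (degIn G x Y₁ : ℝ) + ε * n ^ 2
  sum₂ : (X₂.card : ℝ) * Y₂.card ≤ ∑ x ∈ X₂, (degIn G x Y₂ : ℝ) + ε * n ^ 2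

lemma IsSplit.swap {G : SimpleGraph V} {X₁ X₂ Y₁ Y₂ : Finset V} {n d : ℕ} {θ ε : ℝ}
    (h : IsSplit G X₁ X₂ Y₁ Y₂ n d θ ε) : IsSplit G Y₂ Y₁ X₂ X₁ n d θ ε where
  disjX := h.disjY.symm
  disjY := h.disjX.symm
  cardX := by rw [add_comm]; exact h.cardY
  cardY := by rw [add_comm]; exact h.cardX
  diff := by have := h.diff; have := h.cardX; have := h.cardY; lia
  d_le := h.d_le
  lowX₁ := h.lowY₂
  lowX₂ := h.lowY₁
  lowY₁ := h.lowX₂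
  lowY₂ := h.lowX₁
  degX₁ := h.degY₂
  degX₂ := h.degY₁
  degY₁ := h.degX₂
  degY₂ := h.degX₁
  totalX y hy := by rw [add_comm]; exact h.totalY y hy
  totalY y hy := by rw [add_comm]; exact h.totalX y hy
  crossX := h.crossY
  crossY := h.crossX
  sum₁ := by
    have h2 : ∑ a ∈ X₂, (degIn G a Y₂ : ℝ) = ∑ b ∈ Y₂, (degIn G b X₂ : ℝ) := by
      exact_mod_cast sum_degIn_comm G X₂ Y₂
    rw [← h2, mul_comm]
    exact h.sum₂
  sum₂ := by
    have h2 : ∑ a ∈ X₁, (degIn G a Y₁ : ℝ) = ∑ b ∈ Y₁, (degIn G b X₁ : ℝ) := by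
      exact_mod_cast sum_degIn_comm G X₁ Y₁
    rw [← h2, mul_comm]
    exact h.sum₁

lemma IsSplit.exists_cover {G : SimpleGraph V} {X₁ X₂ Y₁ Y₂ : Finset V} {n d m : ℕ} {θ ε : ℝ}
    (h : IsSplit G X₁ X₂ Y₁ Y₂ n d θ ε) (hm : 0 < m) (hθ : 128 * m * θ = 1)
    (hε : m * ε ≤ θ / 4) (hd : 4 * m ≤ d) (hn : 0 < n)
    (hX : ∀ x ∈ X₁, (d : ℝ) / 2 ≤ degIn G x Y₂) :
    ∃ S ⊆ X₁, ∃ Z ⊆ X₂, ∃ L ⊆ Y₂, S.card = d ∧ Z.card = d * (m - 1) ∧ L.card = d * m ∧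
      Tileable G m (S ∪ Z) L := by
  have hd0 : 0 < d := by lia
  have hm' : (1 : ℝ) ≤ m := by exact_mod_cast hm
  have hn' : (0 : ℝ) < n := by exact_mod_cast hn
  have hd0' : (0 : ℝ) < d := by exact_mod_cast hd0
  have hd' : (4 : ℝ) * m ≤ d := by exact_mod_cast hd
  have hdle := h.d_le
  have hε0 : 0 ≤ ε := by
    by_contra! hlt
    nlinarith
  have hθ1 : θ ≤ 1 / 128 := by
    by_contra! hlt
    nlinarith
  have hε1 : ε ≤ 1 / 512 := by nlinarith
  have hcX : (X₁.card : ℝ) + X₂.card = n := by exact_mod_cast h.cardX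
  have hlX₁ := h.lowX₁
  have hlX₂ := h.lowX₂
  have hεn : ε * n ≤ 1 / 512 * n := by gcongr
  refine exists_greedy_cover (k := d) (μ := (4 * θ + ε) * n) hm h.disjX ?_ ?_ ?_ d le_rfl
  · intro S hS L hL hSd hLc
    by_contra! hcon
    have h1 : ∀ x ∈ X₁ \ S, (d : ℝ) / 4 ≤ degIn G x L := by
      intro x hx
      have a := degIn_union_le G x L (Y₂ \ L)
      rw [union_sdiff_of_subset hL] at a
      have b := hcon x hx
      have c : (degIn G x Y₂ : ℝ) ≤ degIn G x L + m := by exact_mod_cast (by lia)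
      have e := hX x (sdiff_subset hx)
      linarith
    have h2 := card_nsmul_le_sum _ _ _ h1
    have h3 : ∑ x ∈ X₁ \ S, (degIn G x L : ℝ) ≤ ∑ x ∈ X₁, (degIn G x L : ℝ) :=
      sum_le_sum_of_subset_of_nonneg sdiff_subset fun _ _ _ => Nat.cast_nonneg _
    have h4 : ∑ a ∈ X₁, (degIn G a L : ℝ) = ∑ b ∈ L, (degIn G b X₁ : ℝ) := by
      exact_mod_cast sum_degIn_comm G X₁ L
    have h5 := sum_le_card_nsmul L (fun b => (degIn G b X₁ : ℝ)) (4 * θ * n)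
      fun y hy => h.crossY hd0 y (hL hy)
    rw [nsmul_eq_mul] at h2 h5
    have h6 : (L.card : ℝ) ≤ d * m := by
      rw [hLc]
      push_cast
      gcongr
    have h7 : (L.card : ℝ) * (4 * θ * n) ≤ d * m * (4 * θ * n) := by
      have : 0 < θ := by
        by_contra! hle
        nlinarith
      gcongr
    have h8 : (n : ℝ) / 4 ≤ (X₁ \ S).card := by
      have a : ((X₁ \ S).card : ℝ) + S.card = X₁.card := by
        exact_mod_cast card_sdiff_add_card_eq_card hS
      have b : (S.card : ℝ) ≤ d := by exact_mod_cast hSd.le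
      linarith
    have h9 : (n : ℝ) / 4 * (d / 4) ≤ (X₁ \ S).card * (d / 4) := by gcongr
    have h10 : d * m * (4 * θ * n) = n * d / 32 := by linear_combination (n * d / 32 : ℝ) * hθ
    have h11 : 0 < (n : ℝ) * d := by positivity
    linarith
  · intro y hy
    have a := h.totalY y hy
    have b := h.crossY hd0 y hy
    linarith
  · have a : (d : ℝ) * m ≤ m * ε * n := by nlinarith
    have b : m * ε * n ≤ 1 / 512 * n := by
      gcongr
      linarith
    have c : m * ((4 * θ + ε) * n) = 1 / 32 * n + m * ε * n := by
      linear_combination (n / 32 : ℝ) * hθ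
    linarith

/-- Few vertices can be removed from a splitting so that both of its pairs become balanced. -/
lemma IsSplit.exists_balance {G : SimpleGraph V} {X₁ X₂ Y₁ Y₂ : Finset V} {n d m : ℕ} {θ ε : ℝ}
    (h : IsSplit G X₁ X₂ Y₁ Y₂ n d θ ε) (hm : 0 < m) (hθ : 128 * m * θ = 1)
    (hε : m * ε ≤ θ / 4) (hn : 0 < n) :
    ∃ U₁ ⊆ X₁, ∃ U₂ ⊆ X₂, ∃ W₁ ⊆ Y₁, ∃ W₂ ⊆ Y₂, ∃ A ⊆ U₁ ∪ U₂, ∃ B ⊆ W₁ ∪ W₂, Tileable G m A B ∧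
      U₁.card + U₂.card ≤ A.card + 4 * m ∧ X₁.card + W₁.card = Y₁.card + U₁.card ∧
      X₂.card + W₂.card = Y₂.card + U₂.card ∧ U₁.card + U₂.card ≤ d * m ∧
      W₁.card + W₂.card ≤ d * m := by
  have hXc := h.cardX
  have hYc := h.cardY
  have hdiff := h.diff
  have hdm : d ≤ d * m := Nat.le_mul_of_pos_right d hm
  have hdm' : d + d * (m - 1) = d * m := by
    obtain ⟨k, rfl⟩ : ∃ k, m = k + 1 := ⟨m - 1, by lia⟩
    rw [Nat.add_sub_cancel]; ring
  rcases lt_or_ge d (4 * m) with hd | hd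
  · obtain ⟨U, hU, hUc⟩ := exists_subset_card_eq (show d ≤ X₁.card by lia)
    obtain ⟨W, hW, hWc⟩ := exists_subset_card_eq (show d ≤ Y₂.card by lia)
    refine ⟨U, hU, ∅, by simp, ∅, by simp, W, hW, ∅, by simp, ∅, by simp, .empty G m, ?_⟩
    simp only [card_empty]
    lia
  have key : (∀ x ∈ X₁, (d : ℝ) / 2 ≤ degIn G x Y₂) ∨ ∀ y ∈ Y₂, (d : ℝ) / 2 ≤ degIn G y X₁ := by
    have e : (Y₁.card : ℝ) + X₂.card = n - d := by
      have : Y₁.card + X₂.card + d = n := by lia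
      rw [← this]; push_cast; ring
    rcases le_or_gt (Y₁.card : ℝ) ((n - d) / 2) with hle | hgt
    · refine Or.inl fun x hx => ?_
      have a := h.totalX x hx
      have b : (degIn G x Y₁ : ℝ) ≤ Y₁.card := by exact_mod_cast degIn_le_card G x Y₁
      linarith
    · refine Or.inr fun y hy => ?_
      have a := h.totalY y hy
      have b : (degIn G y X₂ : ℝ) ≤ X₂.card := by exact_mod_cast degIn_le_card G y X₂
      linarith
  rcases key with hX | hY
  · obtain ⟨S, hS, Z, hZ, L, hL, hSc, hZc, hLc, hT⟩ := h.exists_cover hm hθ hε hd hn hX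
    have hc := card_union_of_disjoint (h.disjX.mono hS hZ)
    refine ⟨S, hS, Z, hZ, ∅, by simp, L, hL, S ∪ Z, subset_rfl, L, by simp, hT, ?_⟩
    simp only [card_empty]
    lia
  · obtain ⟨S, hS, Z, hZ, L, hL, hSc, hZc, hLc, hT⟩ := h.swap.exists_cover hm hθ hε hd hn hY
    refine ⟨L, hL, ∅, by simp, Z, hZ, S, hS, L, by simp, S ∪ Z, (union_comm S Z).subset,
      hT.swap, ?_⟩
    simp only [card_empty]
    lia

theorem exists_tileable_of_isSplit {m : ℕ} (hm : 0 < m) {θ : ℝ} (hθ : 128 * m * θ = 1) :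
    ∃ ε : ℝ, 0 < ε ∧ ∃ n₀ : ℕ, ∀ (V : Type) (G : SimpleGraph V) (X₁ X₂ Y₁ Y₂ : Finset V)
      (n d : ℕ), n₀ ≤ n → IsSplit G X₁ X₂ Y₁ Y₂ n d θ ε →
      ∃ A ⊆ X₁ ∪ X₂, ∃ B ⊆ Y₁ ∪ Y₂, Tileable G m A B ∧ n ≤ A.card + 6 * m := by
  have hm' : (1 : ℝ) ≤ m := by exact_mod_cast hm
  have hθ0 : 0 < θ := by
    by_contra! hlt
    nlinarith
  have hθ1 : θ ≤ 1 / 128 := by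
    by_contra! hlt
    nlinarith
  obtain ⟨ε, hε, n₀, hn₀⟩ := exists_tileable_of_nearly_complete_subset hm hθ0 (by linarith)
  refine ⟨min ε (θ / (4 * m)), by positivity, max n₀ 1, fun V G X₁ X₂ Y₁ Y₂ n d hn h => ?_⟩
  set ε' := min ε (θ / (4 * m)) with hε'
  have hε'0 : 0 < ε' := by positivity
  have hmε : m * ε' ≤ θ / 4 := by
    calc m * ε' ≤ m * (θ / (4 * m)) := by gcongr; exact min_le_right _ _
      _ = θ / 4 := by field_simp
  have hε1 : ε' ≤ 1 / 512 := by nlinarith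
  have hn1 := le_trans (le_max_left _ _) hn
  have hn0 : 0 < n := le_trans (le_max_right _ _) hn
  obtain ⟨U₁, hU₁, U₂, hU₂, W₁, hW₁, W₂, hW₂, A₀, hA₀, B₀, hB₀, hT, hUA, he₁, he₂, hUd, hWd⟩ :=
    h.exists_balance hm hθ hmε hn0
  have hdm : ((d * m : ℕ) : ℝ) ≤ θ / 2 * n := by
    push_cast
    calc (d : ℝ) * m ≤ ε' * n * m := by gcongr; exact h.d_le
      _ = m * ε' * n := by ring
      _ ≤ θ / 2 * n := by gcongr; linarith
  have hεn : ε' * n ≤ 1 / 512 * n := by gcongr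
  have hθn : θ * n ≤ 1 / 128 * n := by gcongr
  have hsum : ε' * n ^ 2 ≤ ε * n ^ 2 := by gcongr; exact min_le_left _ _
  have hsd : ∀ {A B : Finset V}, A ⊆ B → A.card ≤ d * m → ((B \ (B \ A)).card : ℝ) ≤ θ / 2 * n := by
    intro A B hAB hA
    rw [Finset.sdiff_sdiff_eq_self hAB]
    exact le_trans (by exact_mod_cast hA) hdm
  have c₁ := card_sdiff_add_card_eq_card hU₁
  have c₂ := card_sdiff_add_card_eq_card hU₂
  have c₃ := card_sdiff_add_card_eq_card hW₁
  have c₄ := card_sdiff_add_card_eq_card hW₂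
  have hXc := h.cardX
  have low : ∀ {A B : Finset V}, (B \ A).card + A.card = B.card → A.card ≤ d * m →
      (1 / 2 - ε') * n ≤ B.card → (n : ℝ) / 4 ≤ (B \ A).card := by
    intro A B hAB hA hB
    have a : ((B \ A).card : ℝ) + A.card = B.card := by exact_mod_cast hAB
    have b : (A.card : ℝ) ≤ θ / 2 * n := le_trans (by exact_mod_cast hA) hdm
    linarith
  obtain ⟨A₁, hA₁, B₁, hB₁, hT₁, hc₁⟩ := hn₀ V G X₁ Y₁ (X₁ \ U₁) (Y₁ \ W₁) n hn1 sdiff_subset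
    sdiff_subset (by lia) (low c₁ (by lia) h.lowX₁) (by lia) (hsd hU₁ (by lia)) (hsd hW₁ (by lia))
    h.degX₁ h.degY₁ (by linarith [h.sum₁])
  obtain ⟨A₂, hA₂, B₂, hB₂, hT₂, hc₂⟩ := hn₀ V G X₂ Y₂ (X₂ \ U₂) (Y₂ \ W₂) n hn1 sdiff_subset
    sdiff_subset (by lia) (low c₂ (by lia) h.lowX₂) (by lia) (hsd hU₂ (by lia)) (hsd hW₂ (by lia))
    h.degX₂ h.degY₂ (by linarith [h.sum₂])
  have d₁ : Disjoint A₁ A₂ := h.disjX.mono (hA₁.trans sdiff_subset) (hA₂.trans sdiff_subset)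
  have d₂ : Disjoint B₁ B₂ := h.disjY.mono (hB₁.trans sdiff_subset) (hB₂.trans sdiff_subset)
  have d₃ : Disjoint A₀ (A₁ ∪ A₂) := by
    refine Disjoint.mono_left hA₀ ?_
    simp only [disjoint_union_left, disjoint_union_right]
    exact ⟨⟨disjoint_sdiff.mono_right hA₁, h.disjX.symm.mono hU₂ (hA₁.trans sdiff_subset)⟩,
      h.disjX.mono hU₁ (hA₂.trans sdiff_subset), disjoint_sdiff.mono_right hA₂⟩
  have d₄ : Disjoint B₀ (B₁ ∪ B₂) := by
    refine Disjoint.mono_left hB₀ ?_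
    simp only [disjoint_union_left, disjoint_union_right]
    exact ⟨⟨disjoint_sdiff.mono_right hB₁, h.disjY.symm.mono hW₂ (hB₁.trans sdiff_subset)⟩,
      h.disjY.mono hW₁ (hB₂.trans sdiff_subset), disjoint_sdiff.mono_right hB₂⟩
  refine ⟨A₀ ∪ (A₁ ∪ A₂), ?_, B₀ ∪ (B₁ ∪ B₂), ?_, hT.union (hT₁.union hT₂ d₁ d₂) d₃ d₄, ?_⟩
  · exact union_subset (hA₀.trans (union_subset_union hU₁ hU₂))
      (union_subset_union (hA₁.trans sdiff_subset) (hA₂.trans sdiff_subset))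
  · exact union_subset (hB₀.trans (union_subset_union hW₁ hW₂))
      (union_subset_union (hB₁.trans sdiff_subset) (hB₂.trans sdiff_subset))
  · rw [card_union_of_disjoint d₃, card_union_of_disjoint d₁]
    lia

/-- A partition of a bipartite graph of large minimum degree into two nearly complete pairs `(A, B)`
and `(X \ A, Y \ B)`. -/
structure IsCore (G : SimpleGraph V) (X Y A B : Finset V) (n : ℕ) (c : ℝ) : Prop where
  subX : A ⊆ X
  subY : B ⊆ Y
  cardX : X.card = n
  cardY : Y.card = n
  degX : ∀ x ∈ X, (n : ℝ) / 2 ≤ degIn G x Y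
  degY : ∀ y ∈ Y, (n : ℝ) / 2 ≤ degIn G y X
  lowX₁ : (1 / 2 - 3 * c) * n ≤ A.card
  lowX₂ : (1 / 2 - 3 * c) * n ≤ (X \ A).card
  lowY₁ : (1 / 2 - 3 * c) * n ≤ B.card
  lowY₂ : (1 / 2 - 3 * c) * n ≤ (Y \ B).card
  sum₁ : (A.card : ℝ) * B.card ≤ ∑ x ∈ A, (degIn G x B : ℝ) + 2 * c * n ^ 2
  sum₂ : ((X \ A).card : ℝ) * (Y \ B).card ≤
    ∑ x ∈ X \ A, (degIn G x (Y \ B) : ℝ) + 2 * c * n ^ 2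

lemma IsCore.swap {G : SimpleGraph V} {X Y A B : Finset V} {n : ℕ} {c : ℝ}
    (h : IsCore G X Y A B n c) : IsCore G Y X B A n c where
  subX := h.subY
  subY := h.subX
  cardX := h.cardY
  cardY := h.cardX
  degX := h.degY
  degY := h.degX
  lowX₁ := h.lowY₁
  lowX₂ := h.lowY₂
  lowY₁ := h.lowX₁
  lowY₂ := h.lowX₂
  sum₁ := by
    have h2 : ∑ a ∈ A, (degIn G a B : ℝ) = ∑ b ∈ B, (degIn G b A : ℝ) := by
      exact_mod_cast sum_degIn_comm G A B
    rw [← h2, mul_comm]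
    exact h.sum₁
  sum₂ := by
    have h2 : ∑ a ∈ X \ A, (degIn G a (Y \ B) : ℝ) = ∑ b ∈ Y \ B, (degIn G b (X \ A) : ℝ) := by
      exact_mod_cast sum_degIn_comm G (X \ A) (Y \ B)
    rw [← h2, mul_comm]
    exact h.sum₂

lemma IsCore.compl {G : SimpleGraph V} {X Y A B : Finset V} {n : ℕ} {c : ℝ}
    (h : IsCore G X Y A B n c) : IsCore G X Y (X \ A) (Y \ B) n c where
  subX := sdiff_subset
  subY := sdiff_subset
  cardX := h.cardX
  cardY := h.cardY
  degX := h.degX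
  degY := h.degY
  lowX₁ := h.lowX₂
  lowX₂ := by rw [Finset.sdiff_sdiff_eq_self h.subX]; exact h.lowX₁
  lowY₁ := h.lowY₂
  lowY₂ := by rw [Finset.sdiff_sdiff_eq_self h.subY]; exact h.lowY₁
  sum₁ := h.sum₂
  sum₂ := by
    rw [Finset.sdiff_sdiff_eq_self h.subX, Finset.sdiff_sdiff_eq_self h.subY]
    exact h.sum₁

/-- A bipartite graph of large minimum degree with a sparse pair is nearly the union of two
complete pairs. -/
lemma exists_isCore {G : SimpleGraph V} {X Y : Finset V} {n : ℕ} {c : ℝ} (hc : 0 < c)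
    (hc1 : c ≤ 1 / 6) (hn : 0 < n) (hX : X.card = n) (hY : Y.card = n)
    (hdX : ∀ x ∈ X, (n : ℝ) / 2 ≤ degIn G x Y) (hdY : ∀ y ∈ Y, (n : ℝ) / 2 ≤ degIn G y X)
    (h : ¬ NoSparsePair G X Y n c) : ∃ A B, IsCore G X Y A B n c := by
  simp only [NoSparsePair] at h
  push Not at h
  obtain ⟨S, hS, T, hT, hSc, hTc, hST⟩ := h
  have hn' : (0 : ℝ) < n := by exact_mod_cast hn
  have key : ∀ {X Y S T : Finset V}, Y.card = n → (∀ x ∈ X, (n : ℝ) / 2 ≤ degIn G x Y) → S ⊆ X →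
      T ⊆ Y → X.card = n → (1 / 2 - c) * n ≤ S.card → (1 / 2 - c) * n ≤ T.card →
      ∑ a ∈ S, (degIn G a T : ℝ) < c * n ^ 2 →
      (1 / 2 - 3 * c) * n ≤ (Y \ T).card ∧
        (S.card : ℝ) * (Y \ T).card ≤ ∑ x ∈ S, (degIn G x (Y \ T) : ℝ) + 2 * c * n ^ 2 := by
    intro X Y S T hY hdX hS hT hX hSc hTc hST
    have hsum : (S.card : ℝ) * (n / 2) ≤
        ∑ x ∈ S, (degIn G x (Y \ T) : ℝ) + ∑ x ∈ S, (degIn G x T : ℝ) := by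
      rw [← sum_add_distrib, ← nsmul_eq_mul]
      refine card_nsmul_le_sum _ _ _ fun x hx => (hdX x (hS hx)).trans ?_
      have := degIn_union_le G x (Y \ T) T
      rw [sdiff_union_of_subset hT] at this
      exact_mod_cast this
    have hup : ∑ x ∈ S, (degIn G x (Y \ T) : ℝ) ≤ S.card * (Y \ T).card := by
      rw [← nsmul_eq_mul]
      exact sum_le_card_nsmul _ _ _ fun x _ => by exact_mod_cast degIn_le_card G x _
    have hcard : ((Y \ T).card : ℝ) + T.card = n := by
      rw [← hY]; exact_mod_cast card_sdiff_add_card_eq_card hT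
    have hSn : (S.card : ℝ) ≤ n := by rw [← hX]; exact_mod_cast card_le_card hS
    have hS3 : (n : ℝ) / 3 ≤ S.card := by nlinarith
    constructor
    · by_contra! hlt
      have h1 : (S.card : ℝ) * (Y \ T).card ≤ S.card * ((1 / 2 - 3 * c) * n) := by gcongr
      have h2 : (n : ℝ) / 3 * (3 * c * n) ≤ S.card * (3 * c * n) := by gcongr
      nlinarith
    · have h1 : (S.card : ℝ) * (Y \ T).card ≤ S.card * ((1 / 2 + c) * n) := by
        gcongr
        linarith
      have h2 : (S.card : ℝ) * (c * n) ≤ n * (c * n) := by gcongr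
      nlinarith
  have hTS : ∑ b ∈ T, (degIn G b S : ℝ) < c * n ^ 2 := by
    have h2 : ∑ a ∈ S, (degIn G a T : ℝ) = ∑ b ∈ T, (degIn G b S : ℝ) := by
      exact_mod_cast sum_degIn_comm G S T
    rwa [← h2]
  obtain ⟨h₁, h₂⟩ := key hY hdX hS hT hX hSc hTc hST
  obtain ⟨h₃, h₄⟩ := key hX hdY hT hS hY hTc hSc hTS
  have hcn : 0 < c * n := by positivity
  refine ⟨S, Y \ T, hS, sdiff_subset, hX, hY, hdX, hdY, by linarith, h₃, h₁, ?_, h₂, ?_⟩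
  · rw [Finset.sdiff_sdiff_eq_self hT]
    linarith
  · rw [Finset.sdiff_sdiff_eq_self hT]
    have h2 : ∑ a ∈ X \ S, (degIn G a T : ℝ) = ∑ b ∈ T, (degIn G b (X \ S) : ℝ) := by
      exact_mod_cast sum_degIn_comm G (X \ S) T
    rw [h2, mul_comm]
    exact h₄

/-- The partition `(P, Q)`, `(X \ P, Y \ Q)` is nearly balanced, close to `(A, B)`,
`(X \ A, Y \ B)`, and every vertex has degree at least `t` to its own side of the latter. -/
structure IsNear (G : SimpleGraph V) (X Y A B P Q : Finset V) (t K : ℝ) : Prop where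
  subX : P ⊆ X
  subY : Q ⊆ Y
  degX₁ : ∀ x ∈ P, t ≤ degIn G x B
  degX₂ : ∀ x ∈ X \ P, t ≤ degIn G x (Y \ B)
  degY₁ : ∀ y ∈ Q, t ≤ degIn G y A
  degY₂ : ∀ y ∈ Y \ Q, t ≤ degIn G y (X \ A)
  dist : ((P \ A).card + (A \ P).card + (Q \ B).card + (B \ Q).card : ℝ) +
    |(P.card : ℝ) - Q.card| ≤ K

lemma IsNear.swap {G : SimpleGraph V} {X Y A B P Q : Finset V} {t K : ℝ}
    (h : IsNear G X Y A B P Q t K) : IsNear G Y X B A Q P t K where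
  subX := h.subY
  subY := h.subX
  degX₁ := h.degY₁
  degX₂ := h.degY₂
  degY₁ := h.degX₁
  degY₂ := h.degX₂
  dist := by rw [abs_sub_comm]; linarith [h.dist]

lemma IsNear.compl {G : SimpleGraph V} {X Y A B P Q : Finset V} {t K : ℝ}
    (h : IsNear G X Y A B P Q t K) (hA : A ⊆ X) (hB : B ⊆ Y) (hXY : X.card = Y.card) :
    IsNear G X Y (X \ A) (Y \ B) (X \ P) (Y \ Q) t K where
  subX := sdiff_subset
  subY := sdiff_subset
  degX₁ := h.degX₂
  degX₂ := by
    rw [Finset.sdiff_sdiff_eq_self h.subX, Finset.sdiff_sdiff_eq_self hB]; exact h.degX₁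
  degY₁ := h.degY₂
  degY₂ := by
    rw [Finset.sdiff_sdiff_eq_self h.subY, Finset.sdiff_sdiff_eq_self hA]; exact h.degY₁
  dist := by
    have e₁ : (X \ A) \ (X \ P) = P \ A := by have := h.subX; grind
    have e₂ : (X \ P) \ (X \ A) = A \ P := by grind
    have e₃ : (Y \ B) \ (Y \ Q) = Q \ B := by have := h.subY; grind
    have e₄ : (Y \ Q) \ (Y \ B) = B \ Q := by grind
    have c₁ : ((X \ P).card : ℝ) + P.card = X.card := by
      exact_mod_cast card_sdiff_add_card_eq_card h.subX
    have c₂ : ((Y \ Q).card : ℝ) + Q.card = Y.card := by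
      exact_mod_cast card_sdiff_add_card_eq_card h.subY
    have c₃ : (X.card : ℝ) = Y.card := by exact_mod_cast hXY
    have e₅ : ((X \ P).card : ℝ) - (Y \ Q).card = Q.card - P.card := by linarith
    rw [e₁, e₂, e₃, e₄, e₅, abs_sub_comm]
    linarith [h.dist]

lemma IsNear.erase {G : SimpleGraph V} {X Y A B P Q : Finset V} {t K : ℝ}
    (h : IsNear G X Y A B P Q t K) (hPQ : Q.card < P.card) {x : V} (hx : x ∈ P)
    (hxt : t ≤ degIn G x (Y \ B)) : IsNear G X Y A B (P.erase x) Q t K where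
  subX := (erase_subset x P).trans h.subX
  subY := h.subY
  degX₁ z hz := h.degX₁ z (mem_of_mem_erase hz)
  degX₂ z hz := by
    by_cases hzx : z = x
    · rwa [hzx]
    · exact h.degX₂ z (by grind)
  degY₁ := h.degY₁
  degY₂ := h.degY₂
  dist := by
    have a : (((P.erase x) \ A).card : ℝ) ≤ (P \ A).card := by
      exact_mod_cast card_le_card (sdiff_subset_sdiff (erase_subset x P) subset_rfl)
    have b : ((A \ P.erase x).card : ℝ) ≤ (A \ P).card + 1 := by
      have : A \ P.erase x ⊆ insert x (A \ P) := by grind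
      exact_mod_cast (card_le_card this).trans (card_insert_le _ _)
    have c : ((P.erase x).card : ℝ) + 1 = P.card := by
      exact_mod_cast card_erase_add_one hx
    have d : (Q.card : ℝ) + 1 ≤ P.card := by exact_mod_cast hPQ
    have e := h.dist
    rw [abs_of_nonneg (by linarith)] at e ⊢
    linarith

/-- A nearby partition that is as balanced as possible. -/
lemma IsNear.exists_minimal {G : SimpleGraph V} {X Y A B P₀ Q₀ : Finset V} {t K : ℝ}
    (h₀ : IsNear G X Y A B P₀ Q₀ t K) (hA : A ⊆ X) (hB : B ⊆ Y) (hXY : X.card = Y.card) :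
    ∃ P Q, IsNear G X Y A B P Q t K ∧
      (Q.card < P.card → (∀ x ∈ P, degIn G x (Y \ B) < t) ∧ ∀ y ∈ Y \ Q, degIn G y A < t) ∧
      (P.card < Q.card → (∀ y ∈ Q, degIn G y (X \ A) < t) ∧ ∀ x ∈ X \ P, degIn G x B < t) := by
  have hex : ∃ k : ℕ, ∃ P Q, IsNear G X Y A B P Q t K ∧ ((P.card : ℤ) - Q.card).natAbs = k :=
    ⟨_, P₀, Q₀, h₀, rfl⟩
  obtain ⟨P, Q, h, hk⟩ := Nat.find_spec hex
  have hmin : ∀ P' Q', IsNear G X Y A B P' Q' t K →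
      ((P.card : ℤ) - Q.card).natAbs ≤ ((P'.card : ℤ) - Q'.card).natAbs := by
    intro P' Q' h'
    rw [hk]
    exact Nat.find_min' hex ⟨P', Q', h', rfl⟩
  have key : ∀ {X Y A B P Q : Finset V}, IsNear G X Y A B P Q t K → A ⊆ X → B ⊆ Y →
      X.card = Y.card → Q.card < P.card →
      (∀ P' Q', IsNear G X Y A B P' Q' t K →
        ((P.card : ℤ) - Q.card).natAbs ≤ ((P'.card : ℤ) - Q'.card).natAbs) →
      (∀ x ∈ P, degIn G x (Y \ B) < t) ∧ ∀ y ∈ Y \ Q, degIn G y A < t := by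
    intro X Y A B P Q h hA hB hXY hPQ hmin
    have cX := card_sdiff_add_card_eq_card h.subX
    have cY := card_sdiff_add_card_eq_card h.subY
    constructor
    · intro x hx
      by_contra! hcon
      have a := hmin _ _ (h.erase hPQ hx hcon)
      have b := card_erase_add_one hx
      lia
    · intro y hy
      by_contra! hcon
      rw [← Finset.sdiff_sdiff_eq_self hA] at hcon
      have h' := ((h.compl hA hB hXY).swap.erase (by lia) hy hcon).compl sdiff_subset sdiff_subset
        hXY.symm
      rw [Finset.sdiff_sdiff_eq_self hA, Finset.sdiff_sdiff_eq_self hB,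
        Finset.sdiff_sdiff_eq_self h.subX] at h'
      have a := hmin _ _ h'.swap
      have b := card_erase_add_one hy
      have c := card_sdiff_add_card_eq_card
        ((erase_subset y _).trans (sdiff_subset (s := Y) (t := Q)))
      lia
  refine ⟨P, Q, h, fun hlt => key h hA hB hXY hlt hmin, fun hlt => ?_⟩
  refine key h.swap hB hA hXY.symm hlt fun P' Q' h' => ?_
  have := hmin _ _ h'.swap
  lia

lemma IsCore.exists_isNear {G : SimpleGraph V} {X Y A B : Finset V} {n : ℕ} {c t : ℝ}
    (h : IsCore G X Y A B n c) (hn : 0 < n) (hc : 0 < c) (hc1 : c ≤ 1 / 24) (ht : t ≤ n / 8) :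
    ∃ P Q, IsNear G X Y A B P Q t (68 * c * n) := by
  have hn' : (0 : ℝ) < n := by exact_mod_cast hn
  have hbad : ∀ {X Y A B : Finset V}, IsCore G X Y A B n c →
      ((A.filter fun x => degIn G x B < t).card : ℝ) ≤ 8 * c * n := by
    intro X Y A B h
    have a : ((A.filter fun x => degIn G x B < t).card : ℝ) * (n / 4) ≤
        ∑ x ∈ A.filter (fun x => degIn G x B < t), ((B.card : ℝ) - degIn G x B) := by
      rw [← nsmul_eq_mul]
      refine card_nsmul_le_sum _ _ _ fun x hx => ?_
      have := (mem_filter.1 hx).2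
      have := h.lowY₁
      nlinarith
    have b : ∑ x ∈ A.filter (fun x => degIn G x B < t), ((B.card : ℝ) - degIn G x B) ≤
        ∑ x ∈ A, ((B.card : ℝ) - degIn G x B) := by
      refine sum_le_sum_of_subset_of_nonneg (filter_subset _ _) fun x _ _ => ?_
      rw [sub_nonneg]
      exact_mod_cast degIn_le_card G x B
    have e := a.trans b
    rw [sum_sub_distrib, sum_const, nsmul_eq_mul] at e
    have := h.sum₁
    by_contra! hcon
    nlinarith
  have hdist : ∀ {X Y A B : Finset V}, IsCore G X Y A B n c → ∃ P ⊆ X,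
      (∀ x ∈ P, t ≤ degIn G x B) ∧ (∀ x ∈ X \ P, t ≤ degIn G x (Y \ B)) ∧
      ((P \ A).card : ℝ) ≤ 8 * c * n ∧ ((A \ P).card : ℝ) ≤ 8 * c * n := by
    intro X Y A B h
    have htot : ∀ x ∈ X, (n : ℝ) / 2 ≤ degIn G x B + degIn G x (Y \ B) := by
      intro x hx
      refine (h.degX x hx).trans ?_
      have := degIn_union_le G x B (Y \ B)
      rw [union_sdiff_of_subset h.subY] at this
      exact_mod_cast this
    refine ⟨(A.filter fun x => t ≤ degIn G x B) ∪
      (X \ A).filter (fun x => degIn G x (Y \ B) < t), ?_, ?_, ?_, ?_, ?_⟩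
    · exact union_subset ((filter_subset _ _).trans h.subX)
        ((filter_subset _ _).trans sdiff_subset)
    · intro x hx
      rcases mem_union.1 hx with hx | hx
      · exact (mem_filter.1 hx).2
      · have a := (mem_filter.1 hx).2
        have b := htot x (sdiff_subset (mem_filter.1 hx).1)
        linarith
    · intro x hx
      by_contra! hcon
      have b := htot x (sdiff_subset hx)
      have e : t ≤ degIn G x B := by linarith
      grind
    · refine le_trans ?_ (hbad h.compl)
      exact_mod_cast card_le_card (by grind)
    · refine le_trans ?_ (hbad h)
      exact_mod_cast card_le_card (by grind)
  obtain ⟨P, hP, p₁, p₂, p₃, p₄⟩ := hdist h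
  obtain ⟨Q, hQ, q₁, q₂, q₃, q₄⟩ := hdist h.swap
  refine ⟨P, Q, hP, hQ, p₁, p₂, q₁, q₂, ?_⟩
  have hcard : ∀ P A : Finset V, (P.card : ℝ) + (A \ P).card = A.card + (P \ A).card := by
    intro P A
    have a := card_sdiff_add_card P A
    have b := card_sdiff_add_card A P
    rw [union_comm] at b
    exact_mod_cast (by lia)
  have e₁ := hcard P A
  have e₂ := hcard Q B
  have f₁ : ((X \ A).card : ℝ) + A.card = n := by
    rw [← h.cardX]; exact_mod_cast card_sdiff_add_card_eq_card h.subX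
  have f₂ : ((Y \ B).card : ℝ) + B.card = n := by
    rw [← h.cardY]; exact_mod_cast card_sdiff_add_card_eq_card h.subY
  have := h.lowX₁
  have := h.lowX₂
  have := h.lowY₁
  have := h.lowY₂
  have hcn : 0 < c * n := by positivity
  have : |(P.card : ℝ) - Q.card| ≤ 22 * c * n := by
    have : (0 : ℝ) ≤ (P \ A).card := by positivity
    have : (0 : ℝ) ≤ (Q \ B).card := by positivity
    have : (0 : ℝ) ≤ (A \ P).card := by positivity
    have : (0 : ℝ) ≤ (B \ Q).card := by positivity
    rw [abs_le]
    constructor <;> nlinarith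
  nlinarith

lemma IsCore.sum_le {G : SimpleGraph V} {X Y A B P Q : Finset V} {n : ℕ} {c δ : ℝ}
    (h : IsCore G X Y A B n c) (hP : P ⊆ X) (hQ : Q ⊆ Y)
    (hd : ((P \ A).card : ℝ) + (Q \ B).card ≤ δ * n) :
    (P.card : ℝ) * Q.card ≤ ∑ x ∈ P, (degIn G x Q : ℝ) + (2 * c + δ) * n ^ 2 := by
  have a := card_mul_card_le_sum_degIn_of_subset (P' := P ∩ A) (Q' := Q ∩ B)
    inter_subset_right inter_subset_right h.sum₁
  have b : ∑ x ∈ P ∩ A, (degIn G x (Q ∩ B) : ℝ) ≤ ∑ x ∈ P, (degIn G x Q : ℝ) :=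
    (sum_le_sum fun x _ => by exact_mod_cast degIn_mono G x inter_subset_left).trans
      (sum_le_sum_of_subset_of_nonneg inter_subset_left fun _ _ _ => by positivity)
  have e₁ : (P.card : ℝ) = (P \ A).card + (P ∩ A).card := by
    exact_mod_cast (card_sdiff_add_card_inter P A).symm
  have e₂ : (Q.card : ℝ) = (Q \ B).card + (Q ∩ B).card := by
    exact_mod_cast (card_sdiff_add_card_inter Q B).symm
  have hPn : ((P ∩ A).card : ℝ) ≤ n := by
    rw [← h.cardX]; exact_mod_cast card_le_card (inter_subset_left.trans hP)
  have hQn : (Q.card : ℝ) ≤ n := by rw [← h.cardY]; exact_mod_cast card_le_card hQ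
  have f₁ : ((P \ A).card : ℝ) * Q.card ≤ (P \ A).card * n := by gcongr
  have f₂ : ((P ∩ A).card : ℝ) * (Q \ B).card ≤ n * (Q \ B).card := by gcongr
  have f₃ : (((P \ A).card : ℝ) + (Q \ B).card) * n ≤ δ * n * n := by gcongr
  have f₄ : (P.card : ℝ) * Q.card =
      (P \ A).card * Q.card + (P ∩ A).card * (Q \ B).card + (P ∩ A).card * (Q ∩ B).card := by
    rw [e₁, e₂]; ring
  linarith

lemma IsNear.isSplit {G : SimpleGraph V} {X Y A B P Q : Finset V} {n d : ℕ} {c θ ε : ℝ}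
    (h : IsNear G X Y A B P Q (2 * θ * n) (68 * c * n)) (hG : IsCore G X Y A B n c)
    (hc : 0 < c) (hcε : 71 * c ≤ ε) (hcθ : 68 * c ≤ θ) (hd : P.card = Q.card + d)
    (hmin : Q.card < P.card → (∀ x ∈ P, degIn G x (Y \ B) < 2 * θ * n) ∧
      ∀ y ∈ Y \ Q, degIn G y A < 2 * θ * n) :
    IsSplit G P (X \ P) Q (Y \ Q) n d θ ε := by
  have hdist := h.dist
  have hn' : (0 : ℝ) ≤ n := by positivity
  have hcn : 0 ≤ c * n := by positivity
  have hdR : (P.card : ℝ) = Q.card + d := by exact_mod_cast hd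
  have habs : |(P.card : ℝ) - Q.card| = d := by
    rw [hdR, add_sub_cancel_left, Nat.abs_cast]
  rw [habs] at hdist
  have i₁ : (0 : ℝ) ≤ (P \ A).card := by positivity
  have i₂ : (0 : ℝ) ≤ (Q \ B).card := by positivity
  have i₃ : (0 : ℝ) ≤ (A \ P).card := by positivity
  have i₄ : (0 : ℝ) ≤ (B \ Q).card := by positivity
  have i₅ : (0 : ℝ) ≤ d := by positivity
  have hε : 71 * c * n ≤ ε * n := by gcongr
  have hθ : 68 * c * n ≤ θ * n := by gcongr
  have g : ∀ A P : Finset V, (A.card : ℝ) ≤ P.card + (A \ P).card := by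
    intro A P
    have := card_le_card (subset_union_left (s₁ := A) (s₂ := P))
    rw [← card_sdiff_add_card] at this
    exact_mod_cast (by lia)
  have e₁ : (X \ A) \ (X \ P) = P \ A := by have := h.subX; grind
  have e₂ : (X \ P) \ (X \ A) = A \ P := by have := hG.subX; grind
  have e₃ : (Y \ B) \ (Y \ Q) = Q \ B := by have := h.subY; grind
  have e₄ : (Y \ Q) \ (Y \ B) = B \ Q := by have := hG.subY; grind
  have D : ∀ (x : V) (S T : Finset V), (degIn G x S : ℝ) ≤ degIn G x T + (S \ T).card :=
    fun x S T => by exact_mod_cast degIn_le_add_sdiff G x S T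
  have hn2 : (2 * c + 68 * c) * (n : ℝ) ^ 2 ≤ ε * n ^ 2 := by gcongr; linarith
  have total : ∀ {Y Q : Finset V} (x : V), Q ⊆ Y → (n : ℝ) / 2 ≤ degIn G x Y →
      (n : ℝ) / 2 ≤ degIn G x Q + degIn G x (Y \ Q) := by
    intro Y Q x hQ hx
    refine hx.trans ?_
    have := degIn_union_le G x Q (Y \ Q)
    rw [union_sdiff_of_subset hQ] at this
    exact_mod_cast this
  refine ⟨disjoint_sdiff, disjoint_sdiff, ?_, ?_, hd, by linarith, ?_, ?_, ?_, ?_, ?_, ?_, ?_, ?_,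
    ?_, ?_, ?_, ?_, ?_, ?_⟩
  · rw [← hG.cardX, add_comm]; exact card_sdiff_add_card_eq_card h.subX
  · rw [← hG.cardY, add_comm]; exact card_sdiff_add_card_eq_card h.subY
  · linarith [hG.lowX₁, g A P]
  · have := g (X \ A) (X \ P)
    rw [e₁] at this
    linarith [hG.lowX₂]
  · linarith [hG.lowY₁, g B Q]
  · have := g (Y \ B) (Y \ Q)
    rw [e₃] at this
    linarith [hG.lowY₂]
  · intro x hx
    linarith [h.degX₁ x hx, D x B Q]
  · intro x hx
    have := D x (Y \ B) (Y \ Q)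
    rw [e₃] at this
    linarith [h.degX₂ x hx]
  · intro x hx
    linarith [h.degY₁ x hx, D x A P]
  · intro x hx
    have := D x (X \ A) (X \ P)
    rw [e₁] at this
    linarith [h.degY₂ x hx]
  · exact fun x hx => total x h.subY (hG.degX x (h.subX hx))
  · exact fun y hy => total y h.subX (hG.degY y (sdiff_subset hy))
  · intro hd0 x hx
    have a := (hmin (by lia)).1 x hx
    have b := D x (Y \ Q) (Y \ B)
    rw [e₄] at b
    linarith
  · intro hd0 y hy
    have a := (hmin (by lia)).2 y hy
    have b := D y P A
    linarith
  · exact (hG.sum_le h.subX h.subY (δ := 68 * c) (by linarith)).trans (by linarith)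
  · exact (hG.compl.sum_le sdiff_subset sdiff_subset (δ := 68 * c)
      (by rw [e₂, e₄]; linarith)).trans (by linarith)

/-- A balanced bipartite graph with classes of size `n` and minimum degree at least `n / 2` has a
`K_{m,m}`-tiling that misses at most `6 * m` vertices of each class. -/
theorem exists_tileable {m : ℕ} (hm : 0 < m) :
    ∃ n₀ : ℕ, ∀ (V : Type) (G : SimpleGraph V) (X Y : Finset V) (n : ℕ), n₀ ≤ n →
      X.card = n → Y.card = n → (∀ x ∈ X, (n : ℝ) / 2 ≤ degIn G x Y) →
      (∀ y ∈ Y, (n : ℝ) / 2 ≤ degIn G y X) →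
      ∃ A ⊆ X, ∃ B ⊆ Y, Tileable G m A B ∧ n ≤ A.card + 6 * m := by
  have hm' : (1 : ℝ) ≤ m := by exact_mod_cast hm
  obtain ⟨θ, hθ⟩ : ∃ θ : ℝ, 128 * m * θ = 1 := ⟨1 / (128 * m), by field_simp⟩
  have hθ0 : 0 < θ := by
    by_contra! hlt
    nlinarith
  have hθ1 : θ ≤ 1 / 128 := by
    by_contra! hlt
    nlinarith
  obtain ⟨ε, hε, n₁, hn₁⟩ := exists_tileable_of_isSplit hm hθ
  set c := min (ε / 71) (θ / 68) with hc
  have hc0 : 0 < c := by positivity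
  have hcε : 71 * c ≤ ε := by linarith [min_le_left (ε / 71) (θ / 68)]
  have hcθ : 68 * c ≤ θ := by linarith [min_le_right (ε / 71) (θ / 68)]
  obtain ⟨n₂, hn₂⟩ := exists_tileable_of_noSparsePair (m := m) hm hc0 (by linarith)
  refine ⟨max (max n₁ n₂) 1, fun V G X Y n hn hX hY hdX hdY => ?_⟩
  have hn0 : 0 < n := (le_max_right _ _).trans hn
  have hn1 : n₁ ≤ n := (le_max_left _ _).trans ((le_max_left _ _).trans hn)
  have hn2 : n₂ ≤ n := (le_max_right _ _).trans ((le_max_left _ _).trans hn)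
  by_cases hG : NoSparsePair G X Y n c
  · obtain ⟨A, hA, B, hB, hT, hAn⟩ := hn₂ V G X Y n hn2 hX hY hdX hdY hG
    exact ⟨A, hA, B, hB, hT, by lia⟩
  obtain ⟨A, B, hAB⟩ := exists_isCore hc0 (by linarith) hn0 hX hY hdX hdY hG
  obtain ⟨P₀, Q₀, h₀⟩ := hAB.exists_isNear (t := 2 * θ * n) hn0 hc0 (by linarith) (by
    have : θ * n ≤ 1 / 128 * n := by gcongr
    have : (0 : ℝ) ≤ n := by positivity
    linarith)
  obtain ⟨P, Q, h, h₁, h₂⟩ := h₀.exists_minimal hAB.subX hAB.subY (hX.trans hY.symm)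
  rcases le_total Q.card P.card with hle | hle
  · have := hn₁ V G P (X \ P) Q (Y \ Q) n (P.card - Q.card) hn1
      (h.isSplit hAB hc0 hcε hcθ (by lia) h₁)
    rwa [union_sdiff_of_subset h.subX, union_sdiff_of_subset h.subY] at this
  · have := hn₁ V G Q (Y \ Q) P (X \ P) n (Q.card - P.card) hn1
      (h.swap.isSplit hAB.swap hc0 hcε hcθ (by lia) h₂)
    rw [union_sdiff_of_subset h.subX, union_sdiff_of_subset h.subY] at this
    obtain ⟨B', hB', A', hA', hT, hc⟩ := this
    exact ⟨A', hA', B', hB', hT.swap, by have := hT.card_eq; lia⟩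

lemma colorCard_true_add_false [Fintype α] (c : α → Bool) :
    colorCard c true + colorCard c false = Fintype.card α := by
  have := card_filter_add_card_filter_not (s := (univ : Finset α)) (fun v => c v = true)
  simpa only [colorCard, Bool.not_eq_true, card_univ] using this

lemma exists_balanced_coloring [Fintype α] {H : SimpleGraph α} (hbip : IsBip H)
    (hσ : 2 * sigmaBip H = Fintype.card α) :
    ∃ c : α → Bool, Proper2Coloring H c ∧ colorCard c true = sigmaBip H ∧
      colorCard c false = sigmaBip H := by
  obtain ⟨c, hc⟩ := hbip
  have h1 : sigmaBip H ≤ min (colorCard c true) (colorCard c false) := Nat.sInf_le ⟨c, hc, rfl⟩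
  have h2 := colorCard_true_add_false c
  exact ⟨c, hc, by lia, by lia⟩

/-- A complete bipartite graph contains every bipartite graph with the same class sizes. -/
lemma Joined.exists_isCopy [Fintype α] {H : SimpleGraph α} {G : SimpleGraph V} {P Q : Finset V}
    (h : Joined G P Q) (hPQ : Disjoint P Q) {c : α → Bool} (hc : Proper2Coloring H c)
    (hP : P.card = colorCard c true) (hQ : Q.card = colorCard c false) :
    ∃ f : α → V, IsCopy H G f ∧ univ.image f = P ∪ Q := by
  have e₁ : (univ.filter fun v => c v = true) ≃ P := Finset.equivOfCardEq hP.symm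
  have e₂ : (univ.filter fun v => c v = false) ≃ Q := Finset.equivOfCardEq hQ.symm
  set f : α → V := fun a => if ha : c a = true then e₁ ⟨a, by simp [ha]⟩
    else e₂ ⟨a, by simp [ha]⟩ with hf
  have f₁ : ∀ a (ha : c a = true), f a = e₁ ⟨a, by simp [ha]⟩ := fun a ha => by simp [hf, ha]
  have f₂ : ∀ a (ha : c a = false), f a = e₂ ⟨a, by simp [ha]⟩ := fun a ha => by simp [hf, ha]
  have m₁ : ∀ a, c a = true → f a ∈ P := fun a ha => by rw [f₁ a ha]; exact coe_mem _
  have m₂ : ∀ a, c a = false → f a ∈ Q := fun a ha => by rw [f₂ a ha]; exact coe_mem _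
  have hd := disjoint_left.1 hPQ
  refine ⟨f, ⟨fun a b hab => ?_, fun a b hab => ?_⟩, ?_⟩
  · cases ha : c a <;> cases hb : c b
    · rw [f₂ a ha, f₂ b hb] at hab
      simpa using e₂.injective (Subtype.ext hab)
    · exact absurd (m₂ a ha) (hd (hab ▸ m₁ b hb))
    · exact absurd (m₂ b hb) (hd (hab ▸ m₁ a ha))
    · rw [f₁ a ha, f₁ b hb] at hab
      simpa using e₁.injective (Subtype.ext hab)
  · have hne := hc hab
    cases ha : c a <;> cases hb : c b
    · exact absurd (ha.trans hb.symm) hne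
    · exact (h _ (m₁ b hb) _ (m₂ a ha)).symm
    · exact h _ (m₁ a ha) _ (m₂ b hb)
    · exact absurd (ha.trans hb.symm) hne
  · ext v
    simp only [mem_image, mem_univ, true_and, mem_union]
    constructor
    · rintro ⟨a, rfl⟩
      cases ha : c a
      · exact Or.inr (m₂ a ha)
      · exact Or.inl (m₁ a ha)
    · rintro (hv | hv)
      · obtain ⟨⟨a, ha⟩, he⟩ := e₁.surjective ⟨v, hv⟩
        have ha' := (mem_filter.1 ha).2
        exact ⟨a, by rw [f₁ a ha', he]⟩
      · obtain ⟨⟨a, ha⟩, he⟩ := e₂.surjective ⟨v, hv⟩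
        have ha' := (mem_filter.1 ha).2
        exact ⟨a, by rw [f₂ a ha', he]⟩

lemma Tileable.exists_isHTiling [Fintype α] [Fintype V] {H : SimpleGraph α} {G : SimpleGraph V}
    {m : ℕ} {A B : Finset V} (h : Tileable G m A B) (hAB : Disjoint A B) {c : α → Bool}
    (hc : Proper2Coloring H c) (h₁ : colorCard c true = m) (h₂ : colorCard c false = m) :
    ∃ s : Finset (α → V), IsHTiling H G s ∧ coveredSet s = A ∪ B := by
  obtain ⟨R, hR, hA, hB⟩ := h
  have hex : ∀ p ∈ R, ∃ f : α → V, IsCopy H G f ∧ univ.image f = p.1 ∪ p.2 := fun p hp =>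
    (hR.joined p hp).exists_isCopy (hAB.mono (hR.sub₁ p hp) (hR.sub₂ p hp)) hc
      ((hR.card₁ p hp).trans h₁.symm) ((hR.card₂ p hp).trans h₂.symm)
  choose F hF hFim using hex
  have hmem : ∀ p (hp : p ∈ R) a, F p hp a ∈ p.1 ∪ p.2 := fun p hp a => by
    rw [← hFim p hp]
    exact mem_image_of_mem _ (mem_univ a)
  refine ⟨R.attach.image fun p => F p.1 p.2, ⟨?_, ?_⟩, ?_⟩
  · simp only [forall_mem_image]
    exact fun p _ => hF p.1 p.2
  · simp only [forall_mem_image]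
    intro p _ q _ hpq a b hab
    have hne : p.1 ≠ q.1 := fun e => hpq (by rw [Subtype.ext e])
    have hdisj : Disjoint (p.1.1 ∪ p.1.2) (q.1.1 ∪ q.1.2) := by
      simp only [disjoint_union_left, disjoint_union_right]
      exact ⟨⟨hR.disj₁ _ p.2 _ q.2 hne, (hAB.mono (hR.sub₁ _ q.2) (hR.sub₂ _ p.2)).symm⟩,
        hAB.mono (hR.sub₁ _ p.2) (hR.sub₂ _ q.2), hR.disj₂ _ p.2 _ q.2 hne⟩
    exact disjoint_left.1 hdisj (hmem p.1 p.2 a) (hab ▸ hmem q.1 q.2 b)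
  · rw [← hA, ← hB]
    ext v
    simp only [coveredSet, mem_biUnion, mem_union, mem_cov₁, mem_cov₂, exists_mem_image,
      mem_attach, true_and, hFim, Subtype.exists]
    grind

lemma BipartiteWith.degree_le_degIn [Fintype V] {G : SimpleGraph V} {X Y : Finset V}
    (h : BipartiteWith G X Y) {x : V} (hx : x ∈ X) : G.degree x ≤ degIn G x Y := by
  rw [← G.card_neighborFinset_eq_degree]
  refine card_le_card fun y hy => ?_
  rw [SimpleGraph.mem_neighborFinset] at hy
  rcases h.cross hy with h' | h'
  · exact mem_filter.2 ⟨h'.2, hy⟩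
  · exact absurd h'.1 (disjoint_left.1 h.disj hx)

lemma BipartiteWith.swap [Fintype V] {G : SimpleGraph V} {X Y : Finset V}
    (h : BipartiteWith G X Y) : BipartiteWith G Y X where
  disj := h.disj.symm
  cover := by rw [union_comm]; exact h.cover
  cross _ _ hab := (h.cross hab).symm

/-- from Section 5, the case `χ_cr(H) = 2`. Let `H` be a bipartite graph on
`h` vertices with `σ(H) = h/2`. Then there exists `n₀` such that every balanced bipartite graph
`G` on `2n` vertices with `n ≥ n₀` and `δ(G) ≥ n/2` contains an `H`-tiling covering all but at
most `6h(h-1)` vertices. -/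
theorem statement_19 {α : Type*} [Fintype α] (H : SimpleGraph α) (h : ℕ)
    (hh : Fintype.card α = h) (h0 : 0 < h) (hbip : IsBip H)
    (hσ : 2 * sigmaBip H = h) :
    ∃ n₀ : ℕ, ∀ (V : Type) [Fintype V], ∀ (G : SimpleGraph V) (X Y : Finset V) (n : ℕ),
      n₀ ≤ n → BipartiteWith G X Y → X.card = n → Y.card = n →
      (∀ v : V, (n : ℝ) / 2 ≤ G.degree v) →
      HasHTilingMissingAtMost H G (6 * h * (h - 1)) := by
  obtain ⟨c, hc, hc₁, hc₂⟩ := exists_balanced_coloring hbip (hσ.trans hh.symm)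
  have hm : 0 < sigmaBip H := by lia
  obtain ⟨n₀, hn₀⟩ := exists_tileable hm
  refine ⟨n₀, fun V _ G X Y n hn hG hX hY hδ => ?_⟩
  obtain ⟨A, hA, B, hB, hT, hAn⟩ := hn₀ V G X Y n hn hX hY
    (fun x hx => (hδ x).trans (by exact_mod_cast hG.degree_le_degIn hx))
    (fun y hy => (hδ y).trans (by exact_mod_cast hG.swap.degree_le_degIn hy))
  obtain ⟨s, hs, hcov⟩ := hT.exists_isHTiling (hG.disj.mono hA hB) hc hc₁ hc₂
  refine ⟨s, hs, ?_⟩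
  have hsub : univ \ coveredSet s ⊆ (X \ A) ∪ (Y \ B) := by
    rw [hcov, ← hG.cover]
    grind
  have h₁ := (card_le_card hsub).trans (card_union_le _ _)
  have h₂ := card_sdiff_add_card_eq_card hA
  have h₃ := card_sdiff_add_card_eq_card hB
  have h₄ := hT.card_eq
  have h₅ : 6 * h * 1 ≤ 6 * h * (h - 1) := Nat.mul_le_mul_left _ (by lia)
  lia

end BipTiling
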